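/- Let Ω ⊂ ℝ^d be a nonempty, bounded, uniform, open set, let 0 < s < 1, 1 ≤ p < ∞ and 0 ≤ α, β < codim̲_A(∂Ω). If sp + α + β > codim̄_A(∂Ω), then W_0^{s,p;α,β}(Ω) = { f ∈ W^{s,p;α,β}(Ω) : ∫_Ω |f(x)|^p d_Ω(x)^{−sp−α−β} dx < ∞ }. -/

import Mathlib

open MeasureTheory Metric Set Filter
open scoped ENNReal NNReal

noncomputable section

/-- Euclidean space `ℝ^d`. -/
abbrev Rd (d : ℕ) := EuclideanSpace ℝ (Fin d)

/-- `d_Ω(x)`: the distance from `x` to the boundary `∂Ω`. -/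
def distBd {d : ℕ} (Ω : Set (Rd d)) (x : Rd d) : ℝ := Metric.infDist x (frontier Ω)

/-- The `p`-th power of the weighted Gagliardo seminorm `[f]_{W^{s,p;α,β}(Ω)}^p`, with
power-of-distance-to-the-boundary weights `d_Ω(y)^{-β} d_Ω(x)^{-α}`. -/
def gagP {d : ℕ} (Ω : Set (Rd d)) (s p α β : ℝ) (f : Rd d → ℝ) : ℝ≥0∞ :=
  ∫⁻ x in Ω, ∫⁻ y in Ω, ENNReal.ofReal
    (|f x - f y| ^ p / dist x y ^ ((d : ℝ) + s * p)
      * distBd Ω y ^ (-β) * distBd Ω x ^ (-α))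

/-- The weighted Gagliardo seminorm `[f]_{W^{s,p;α,β}(Ω)}`. -/
def gagSemi {d : ℕ} (Ω : Set (Rd d)) (s p α β : ℝ) (f : Rd d → ℝ) : ℝ≥0∞ :=
  gagP Ω s p α β f ^ (1 / p)

/-- Membership in the weighted fractional Sobolev space `W^{s,p;α,β}(Ω)`. -/
def memW {d : ℕ} (Ω : Set (Rd d)) (s p α β : ℝ) (f : Rd d → ℝ) : Prop :=
  MemLp f (ENNReal.ofReal p) (volume.restrict Ω) ∧ gagP Ω s p α β f < ⊤

/-- The norm `‖f‖_{L^p(Ω)} + [f]_{W^{s,p;α,β}(Ω)}` (as an extended real). -/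
def wNorm {d : ℕ} (Ω : Set (Rd d)) (s p α β : ℝ) (f : Rd d → ℝ) : ℝ≥0∞ :=
  eLpNorm f (ENNReal.ofReal p) (volume.restrict Ω) + gagSemi Ω s p α β f

/-- Membership in `W_0^{s,p;α,β}(Ω)`: the closure of `C_c^∞(Ω) ∩ W^{s,p;α,β}(Ω)` in
`W^{s,p;α,β}(Ω)`. -/
def memW0 {d : ℕ} (Ω : Set (Rd d)) (s p α β : ℝ) (f : Rd d → ℝ) : Prop :=
  memW Ω s p α β f ∧ ∀ ε : ℝ, 0 < ε → ∃ φ : Rd d → ℝ,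
    ContDiff ℝ (⊤ : ℕ∞) φ ∧ HasCompactSupport φ ∧ tsupport φ ⊆ Ω ∧ memW Ω s p α β φ ∧
    wNorm Ω s p α β (fun x => f x - φ x) < ENNReal.ofReal ε

/-- The defining set for the lower Assouad codimension: admissible exponents `q`. -/
def lowerCodimSet {d : ℕ} (E : Set (Rd d)) : Set ℝ :=
  {q : ℝ | 0 ≤ q ∧ ∃ C : ℝ, 1 ≤ C ∧ ∀ x ∈ E, ∀ r R : ℝ, 0 < r → r < R →
    ENNReal.ofReal R < EMetric.diam E →
    volume (Metric.cthickening r E ∩ Metric.ball x R)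
      ≤ ENNReal.ofReal (C * (r / R) ^ q) * volume (Metric.ball x R)}

/-- The lower Assouad codimension. -/
def lowerCodimA {d : ℕ} (E : Set (Rd d)) : ℝ := sSup (lowerCodimSet E)

/-- The upper Assouad codimension. -/
def upperCodimA {d : ℕ} (E : Set (Rd d)) : ℝ :=
  sInf {q : ℝ | 0 ≤ q ∧ ∃ c : ℝ, 0 < c ∧ ∀ x ∈ E, ∀ r R : ℝ, 0 < r → r < R →
    ENNReal.ofReal R < EMetric.diam E →
    ENNReal.ofReal (c * (r / R) ^ q) * volume (Metric.ball x R)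
      ≤ volume (Metric.cthickening r E ∩ Metric.ball x R)}

/-- The upper Minkowski dimension. -/
def upperMinkDim {d : ℕ} (E : Set (Rd d)) : ℝ :=
  sInf {t : ℝ | 0 ≤ t ∧
    Filter.limsup (fun r : ℝ =>
        volume (Metric.cthickening r E) * ENNReal.ofReal (r ^ (t - (d : ℝ))))
      (nhdsWithin 0 (Set.Ioi 0)) = 0}

/-- Uniform domain: any two points are joined by a `1`-Lipschitz (arc-length parameterized)
curve of length `≤ C|x-y|` staying quantitatively away from the boundary. -/
def IsUniformDomain {d : ℕ} (Ω : Set (Rd d)) : Prop :=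
  ∃ C : ℝ, 1 ≤ C ∧ ∀ x ∈ Ω, ∀ y ∈ Ω, ∃ (l : ℝ) (γ : ℝ → Rd d),
    0 ≤ l ∧ l ≤ C * dist x y ∧ γ 0 = x ∧ γ l = y ∧
    (∀ t ∈ Set.Icc 0 l, γ t ∈ Ω) ∧
    LipschitzOnWith 1 γ (Set.Icc 0 l) ∧
    ∀ t ∈ Set.Icc 0 l,
      min (dist (γ t) x) (dist (γ t) y) / C ≤ Metric.infDist (γ t) (frontier Ω)

/-- `κ`-plumpness. -/
def IsPlump {d : ℕ} (κ : ℝ) (E : Set (Rd d)) : Prop :=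
  ∀ r : ℝ, 0 < r → ENNReal.ofReal r < EMetric.diam E →
    ∀ x ∈ closure E, ∃ z ∈ Metric.closedBall x r, Metric.ball z (κ * r) ⊆ E

/-- `σ`-homogeneity: `|V(E,x,λ,r)| ≤ L r^d λ^σ` where
`V(E,x,λ,r) = {y : dist(y,E) ≤ r, |x-y| ≤ λ r}`. -/
def IsHomog {d : ℕ} (σ : ℝ) (E : Set (Rd d)) : Prop :=
  ∃ L : ℝ, 0 < L ∧ ∀ x ∈ E, ∀ lam r : ℝ, 1 ≤ lam → 0 < r →
    volume (Metric.cthickening r E ∩ Metric.closedBall x (lam * r))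
      ≤ ENNReal.ofReal (L * r ^ (d : ℝ) * lam ^ σ)

/-- The axis-parallel cube with corner `a` and side length `l`. -/
def cube {d : ℕ} (a : Rd d) (l : ℝ) : Set (Rd d) :=
  {y | ∀ i, y i ∈ Set.Icc (a i) (a i + l)}

/-- Muckenhoupt `A₁` class: `|Q|⁻¹ ∫_Q w ≤ A inf_Q w` for all cubes `Q`. -/
def IsA1 {d : ℕ} (w : Rd d → ℝ) : Prop :=
  (∀ x, 0 < w x) ∧ ∃ A : ℝ, 0 < A ∧ ∀ (a : Rd d) (l : ℝ), 0 < l →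
    ∫⁻ x in cube a l, ENNReal.ofReal (w x)
      ≤ ENNReal.ofReal (A * l ^ (d : ℝ)) * ⨅ y ∈ cube a l, ENNReal.ofReal (w y)

/-- The `p`-th power of the Gagliardo seminorm with general weights `w(x) v(y)`. -/
def gagPW {d : ℕ} (Ω : Set (Rd d)) (s p : ℝ) (w v f : Rd d → ℝ) : ℝ≥0∞ :=
  ∫⁻ x in Ω, ∫⁻ y in Ω, ENNReal.ofReal
    (|f x - f y| ^ p / dist x y ^ ((d : ℝ) + s * p) * w x * v y)

/-- Membership in `W^{s,p;w,v}(Ω)` for general weights. -/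
def memWgen {d : ℕ} (Ω : Set (Rd d)) (s p : ℝ) (w v f : Rd d → ℝ) : Prop :=
  MemLp f (ENNReal.ofReal p) (volume.restrict Ω) ∧ gagPW Ω s p w v f < ⊤

/-- The norm of `W^{s,p;w,v}(Ω)` (as an extended real). -/
def wNormGen {d : ℕ} (Ω : Set (Rd d)) (s p : ℝ) (w v f : Rd d → ℝ) : ℝ≥0∞ :=
  eLpNorm f (ENNReal.ofReal p) (volume.restrict Ω) + gagPW Ω s p w v f ^ (1 / p)

/-- Membership in `W_0^{s,p;w,v}(Ω)`. -/
def memW0gen {d : ℕ} (Ω : Set (Rd d)) (s p : ℝ) (w v f : Rd d → ℝ) : Prop :=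
  memWgen Ω s p w v f ∧ ∀ ε : ℝ, 0 < ε → ∃ φ : Rd d → ℝ,
    ContDiff ℝ (⊤ : ℕ∞) φ ∧ HasCompactSupport φ ∧ tsupport φ ⊆ Ω ∧ memWgen Ω s p w v φ ∧
    wNormGen Ω s p w v (fun x => f x - φ x) < ENNReal.ofReal ε

/-- Membership in `W_c^{s,p;w,v}(Ω)`: the closure of compactly supported measurable
functions. -/
def memWcgen {d : ℕ} (Ω : Set (Rd d)) (s p : ℝ) (w v f : Rd d → ℝ) : Prop :=
  memWgen Ω s p w v f ∧ ∀ ε : ℝ, 0 < ε → ∃ g : Rd d → ℝ,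
    Measurable g ∧ HasCompactSupport g ∧ tsupport g ⊆ Ω ∧ memWgen Ω s p w v g ∧
    wNormGen Ω s p w v (fun x => f x - g x) < ENNReal.ofReal ε

end

/-- The Lebesgue measure of the unit ball of `ℝ^d`, as a real number. -/
noncomputable def unitBallVol (d : ℕ) : ℝ := volume.real (ball (0 : Rd d) 1)

lemma unitBallVol_pos (d : ℕ) : 0 < unitBallVol d :=
  ENNReal.toReal_pos (measure_ball_pos volume _ one_pos).ne' measure_ball_lt_top.ne

lemma volume_ball_eq {d : ℕ} (x : Rd d) {r : ℝ} (hr : 0 < r) :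
    volume (ball x r) = ENNReal.ofReal (unitBallVol d * r ^ (d : ℝ)) := by
  rw [Measure.addHaar_ball_of_pos _ _ hr, finrank_euclideanSpace, Fintype.card_fin,
    mul_comm (unitBallVol d), ENNReal.ofReal_mul (by positivity), Real.rpow_natCast, unitBallVol,
    Measure.real, ENNReal.ofReal_toReal measure_ball_lt_top.ne]

lemma abs_add_rpow_le {p : ℝ} (hp : 0 ≤ p) (a b : ℝ) :
    |a + b| ^ p ≤ 2 ^ p * (|a| ^ p + |b| ^ p) := by
  have h1 : |a + b| ≤ 2 * max |a| |b| := by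
    have := abs_add_le a b
    have := le_max_left |a| |b|
    have := le_max_right |a| |b|
    linarith
  have h0 : 0 ≤ max |a| |b| := le_max_of_le_left (abs_nonneg a)
  calc |a + b| ^ p ≤ (2 * max |a| |b|) ^ p := Real.rpow_le_rpow (abs_nonneg _) h1 hp
    _ = 2 ^ p * (max |a| |b|) ^ p := Real.mul_rpow zero_le_two h0
    _ ≤ 2 ^ p * (|a| ^ p + |b| ^ p) := by
      gcongr
      rcases max_choice |a| |b| with h | h <;> rw [h]
      · exact le_add_of_nonneg_right (by positivity)
      · exact le_add_of_nonneg_left (by positivity)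

section Geometry

variable {d : ℕ} {Ω : Set (Rd d)}

lemma lowerCodimA_eq_zero_of_subsingleton {E : Set (Rd d)} (hE : E.Subsingleton) :
    lowerCodimA E = 0 := by
  have h0 : ediam E = 0 := ediam_subsingleton hE
  refine Real.sSup_of_not_bddAbove fun ⟨M, hM⟩ => ?_
  have : max 0 (M + 1) ∈ lowerCodimSet E :=
    ⟨le_max_left _ _, 1, le_rfl, fun x _ r R _ _ h => absurd (h.trans_eq h0) not_lt_zero⟩
  have := hM this
  have := le_max_right 0 (M + 1)
  linarith

lemma nontrivial_of_lt_lowerCodimA {E : Set (Rd d)} {a : ℝ} (ha0 : 0 ≤ a)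
    (ha : a < lowerCodimA E) : E.Nontrivial := by
  by_contra h
  rw [Set.not_nontrivial_iff] at h
  rw [lowerCodimA_eq_zero_of_subsingleton h] at ha
  linarith

lemma exists_mem_lowerCodimSet {E : Set (Rd d)} {a : ℝ} (ha : a < lowerCodimA E) :
    ∃ q ∈ lowerCodimSet E, a < q :=
  exists_lt_of_lt_csSup ⟨0, le_rfl, 1, le_rfl, fun x _ r R _ _ _ => by
    simpa using measure_mono inter_subset_right⟩ ha

lemma exists_radius_lt_diam {E : Set (Rd d)} (hE : E.Nontrivial) :
    ∃ R₀ : ℝ, 0 < R₀ ∧ ∀ R ≤ R₀, ENNReal.ofReal R < ediam E := by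
  have h : 0 < ediam E := ediam_pos_iff.2 hE
  obtain ⟨r, hr0, hr⟩ := ENNReal.lt_iff_exists_nnreal_btwn.1 h
  refine ⟨r, by exact_mod_cast hr0, fun R hR => lt_of_le_of_lt ?_ hr⟩
  calc ENNReal.ofReal R ≤ ENNReal.ofReal r := ENNReal.ofReal_le_ofReal hR
    _ = r := ENNReal.ofReal_coe_nnreal

lemma continuous_distBd (Ω : Set (Rd d)) : Continuous (distBd Ω) := continuous_infDist_pt _

@[fun_prop]
lemma measurable_distBd (Ω : Set (Rd d)) : Measurable (distBd Ω) :=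
  (continuous_distBd Ω).measurable

lemma distBd_nonneg (x : Rd d) : 0 ≤ distBd Ω x := infDist_nonneg

lemma distBd_le_add (x y : Rd d) : distBd Ω x ≤ distBd Ω y + dist x y :=
  infDist_le_infDist_add_dist

lemma distBd_pos (hopen : IsOpen Ω) (hfr : (frontier Ω).Nonempty) {x : Rd d} (hx : x ∈ Ω) :
    0 < distBd Ω x := by
  refine (isClosed_frontier.notMem_iff_infDist_pos hfr).1 fun h => ?_
  rw [hopen.frontier_eq] at h
  exact h.2 hx

lemma exists_frontier_dist_eq (hfr : (frontier Ω).Nonempty) (x : Rd d) :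
    ∃ ξ ∈ frontier Ω, distBd Ω x = dist x ξ :=
  isClosed_frontier.exists_infDist_eq_dist hfr x

lemma ball_distBd_subset (hopen : IsOpen Ω) {x : Rd d} (hx : x ∈ Ω) :
    ball x (distBd Ω x) ⊆ Ω := by
  rcases (distBd_nonneg (Ω := Ω) x).eq_or_lt with h0 | h0
  · simp [← h0]
  refine (convex_ball x (distBd Ω x)).isPreconnected.subset_left_of_subset_union hopen
    isClosed_closure.isOpen_compl (disjoint_compl_right_iff_subset.2 subset_closure) ?_
    ⟨x, mem_ball_self h0, hx⟩
  intro y hy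
  by_contra hn
  rw [mem_union, mem_compl_iff, not_or, not_not] at hn
  have hyf : y ∈ frontier Ω := by rw [hopen.frontier_eq]; exact ⟨hn.2, hn.1⟩
  have h1 : distBd Ω x ≤ dist x y := infDist_le_dist_of_mem hyf
  rw [mem_ball, dist_comm] at hy
  linarith

lemma cthickening_frontier_eq (hfr : (frontier Ω).Nonempty) {r : ℝ} (hr : 0 ≤ r) :
    cthickening r (frontier Ω) = {x | distBd Ω x ≤ r} := by
  ext x
  rw [mem_cthickening_iff, mem_ofPred_eq, distBd, infDist,
    ENNReal.le_ofReal_iff_toReal_le (infEDist_ne_top hfr) hr]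

end Geometry

lemma rpow_le_of_mem_shell {ρ t γ : ℝ} (ht : 0 < t) (h1 : t / 2 ≤ ρ) (h2 : ρ ≤ t) :
    ρ ^ γ ≤ 2 ^ |γ| * t ^ γ := by
  have hρ : 0 < ρ := by linarith
  rcases le_total 0 γ with h | h
  · calc ρ ^ γ ≤ t ^ γ := Real.rpow_le_rpow hρ.le h2 h
      _ ≤ 2 ^ |γ| * t ^ γ :=
        le_mul_of_one_le_left (by positivity) (Real.one_le_rpow one_le_two (abs_nonneg γ))
  · calc ρ ^ γ ≤ (t / 2) ^ γ := Real.rpow_le_rpow_of_nonpos (by positivity) h1 h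
      _ = 2 ^ |γ| * t ^ γ := by
        rw [Real.div_rpow ht.le zero_le_two, abs_of_nonpos h, Real.rpow_neg zero_le_two]
        ring

/-- Integral of a power of `ρ` over a set decomposed into dyadic shells of `ρ`. -/
lemma lintegral_rpow_le_of_shells {X : Type*} [MeasurableSpace X] {μ : Measure X} {S : Set X}
    {ρ : X → ℝ} {b R M q γ : ℝ} (hb : 0 < b) (hR : 0 < R) (hM : 0 ≤ M) (hsum : b ^ (γ + q) < 1)
    (hcover : ∀ x ∈ S, ∃ j : ℕ, R * b ^ j / 2 ≤ ρ x ∧ ρ x ≤ R * b ^ j)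
    (hshell : ∀ j : ℕ, μ (S ∩ {x | R * b ^ j / 2 ≤ ρ x ∧ ρ x ≤ R * b ^ j}) ≤
      ENNReal.ofReal (M * (R * b ^ j) ^ q)) :
    ∫⁻ x in S, ENNReal.ofReal (ρ x ^ γ) ∂μ ≤
      ENNReal.ofReal (2 ^ |γ| * M * R ^ (γ + q) * (1 - b ^ (γ + q))⁻¹) := by
  set A : ℕ → Set X := fun j => S ∩ {x | R * b ^ j / 2 ≤ ρ x ∧ ρ x ≤ R * b ^ j} with hA
  have hSA : S ⊆ ⋃ j, A j := fun x hx => by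
    obtain ⟨j, hj⟩ := hcover x hx
    exact mem_iUnion.2 ⟨j, hx, hj⟩
  have hbq : 0 ≤ b ^ (γ + q) := by positivity
  have hterm : ∀ j : ℕ, ∫⁻ x in A j, ENNReal.ofReal (ρ x ^ γ) ∂μ ≤
      ENNReal.ofReal (2 ^ |γ| * M * R ^ (γ + q) * (b ^ (γ + q)) ^ j) := fun j => by
    have ht : 0 < R * b ^ j := by positivity
    calc ∫⁻ x in A j, ENNReal.ofReal (ρ x ^ γ) ∂μ
        ≤ ∫⁻ _ in A j, ENNReal.ofReal (2 ^ |γ| * (R * b ^ j) ^ γ) ∂μ :=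
          setLIntegral_mono measurable_const fun x hx =>
            ENNReal.ofReal_le_ofReal (rpow_le_of_mem_shell ht hx.2.1 hx.2.2)
      _ = ENNReal.ofReal (2 ^ |γ| * (R * b ^ j) ^ γ) * μ (A j) := setLIntegral_const _ _
      _ ≤ ENNReal.ofReal (2 ^ |γ| * (R * b ^ j) ^ γ) * ENNReal.ofReal (M * (R * b ^ j) ^ q) := by
          gcongr
          exact hshell j
      _ = ENNReal.ofReal (2 ^ |γ| * M * R ^ (γ + q) * (b ^ (γ + q)) ^ j) := by
          rw [← ENNReal.ofReal_mul (by positivity)]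
          congr 1
          have : (b ^ (γ + q)) ^ j = (b ^ j) ^ (γ + q) := by
            rw [← Real.rpow_natCast, ← Real.rpow_natCast, ← Real.rpow_mul hb.le,
              ← Real.rpow_mul hb.le, mul_comm]
          rw [this, mul_assoc _ (R ^ (γ + q)), ← Real.mul_rpow hR.le (by positivity),
            Real.rpow_add ht]
          ring
  calc ∫⁻ x in S, ENNReal.ofReal (ρ x ^ γ) ∂μ
      ≤ ∫⁻ x in ⋃ j, A j, ENNReal.ofReal (ρ x ^ γ) ∂μ := lintegral_mono_set hSA
    _ ≤ ∑' j, ∫⁻ x in A j, ENNReal.ofReal (ρ x ^ γ) ∂μ := lintegral_iUnion_le _ _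
    _ ≤ ∑' j, ENNReal.ofReal (2 ^ |γ| * M * R ^ (γ + q) * (b ^ (γ + q)) ^ j) :=
        ENNReal.tsum_le_tsum hterm
    _ = ENNReal.ofReal (2 ^ |γ| * M * R ^ (γ + q) * (1 - b ^ (γ + q))⁻¹) := by
        rw [← ENNReal.ofReal_tsum_of_nonneg (fun j => by positivity)
          ((summable_geometric_of_lt_one hbq hsum).mul_left _), tsum_mul_left,
          tsum_geometric_of_lt_one hbq hsum]

/-- Integral of `ρ ^ γ` near `0` when sublevel sets of `ρ` have measure of order `t ^ q`. -/
lemma lintegral_rpow_le_of_sublevel {X : Type*} [MeasurableSpace X] {μ : Measure X} {S : Set X}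
    {ρ : X → ℝ} {R M q γ : ℝ} (hR : 0 < R) (hM : 0 ≤ M) (hq : 0 < γ + q)
    (hS : ∀ x ∈ S, 0 < ρ x ∧ ρ x ≤ R)
    (hμ : ∀ t, 0 < t → t ≤ R → μ (S ∩ {x | ρ x ≤ t}) ≤ ENNReal.ofReal (M * t ^ q)) :
    ∫⁻ x in S, ENNReal.ofReal (ρ x ^ γ) ∂μ ≤
      ENNReal.ofReal (2 ^ |γ| * M * R ^ (γ + q) * (1 - (1 / 2) ^ (γ + q))⁻¹) := by
  refine lintegral_rpow_le_of_shells (by norm_num) hR hM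
    (Real.rpow_lt_one (by norm_num) (by norm_num) hq) (fun x hx => ?_) fun j => ?_
  · obtain ⟨h0, h1⟩ := hS x hx
    obtain ⟨j, hj1, hj2⟩ := exists_nat_pow_near_of_lt_one (x := ρ x / R) (y := (1 / 2 : ℝ))
      (by positivity) (by rwa [div_le_one hR]) (by norm_num) (by norm_num)
    rw [lt_div_iff₀ hR, pow_succ] at hj1
    rw [div_le_iff₀ hR] at hj2
    exact ⟨j, by linarith, by linarith⟩
  · refine (measure_mono (inter_subset_inter_right _ fun x hx => hx.2)).trans
      (hμ _ (by positivity) (mul_le_of_le_one_right hR.le (pow_le_one₀ (by norm_num) (by norm_num))))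

/-- Integral of `ρ ^ γ` over `R ≤ ρ < T` when sublevel sets of `ρ` have measure of order `t ^ q`. -/
lemma lintegral_rpow_le_of_superlevel {X : Type*} [MeasurableSpace X] {μ : Measure X} {S : Set X}
    {ρ : X → ℝ} {R T M q γ : ℝ} (hR : 0 < R) (hM : 0 ≤ M) (hq : γ + q < 0)
    (hS : ∀ x ∈ S, R ≤ ρ x ∧ ρ x < T)
    (hμ : ∀ t, R ≤ t → t ≤ 2 * T → μ (S ∩ {x | ρ x ≤ t}) ≤ ENNReal.ofReal (M * t ^ q)) :
    ∫⁻ x in S, ENNReal.ofReal (ρ x ^ γ) ∂μ ≤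
      ENNReal.ofReal (2 ^ |γ| * M * (2 * R) ^ (γ + q) * (1 - 2 ^ (γ + q))⁻¹) := by
  refine lintegral_rpow_le_of_shells (by norm_num) (by positivity) hM
    (Real.rpow_lt_one_of_one_lt_of_neg (by norm_num) hq) (fun x hx => ?_) fun j => ?_
  · obtain ⟨h0, h1⟩ := hS x hx
    obtain ⟨j, hj1, hj2⟩ := exists_nat_pow_near (x := ρ x / R) (y := (2 : ℝ))
      (by rwa [one_le_div hR]) (by norm_num)
    rw [div_lt_iff₀ hR, pow_succ] at hj2
    rw [le_div_iff₀ hR] at hj1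
    exact ⟨j, by linarith, by linarith⟩
  · by_cases hj : 2 * R * 2 ^ j ≤ 2 * T
    · refine (measure_mono (inter_subset_inter_right _ fun x hx => hx.2)).trans
        (hμ _ ?_ hj)
      have : (1 : ℝ) ≤ 2 ^ j := one_le_pow₀ one_le_two
      nlinarith
    · have : S ∩ {x | 2 * R * 2 ^ j / 2 ≤ ρ x ∧ ρ x ≤ 2 * R * 2 ^ j} = ∅ := by
        refine eq_empty_of_forall_notMem fun x hx => ?_
        have h1 := (hS x hx.1).2
        have h2 : 2 * R * 2 ^ j / 2 ≤ ρ x := hx.2.1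
        linarith
      rw [this, measure_empty]
      exact zero_le

section Weights

variable {d : ℕ} {Ω : Set (Rd d)}

lemma exists_lintegral_distBd_rpow_ball_le (hopen : IsOpen Ω) (hfr : (frontier Ω).Nontrivial)
    {β : ℝ} (hβ : β < lowerCodimA (frontier Ω)) :
    ∃ C R₀ : ℝ, 0 ≤ C ∧ 0 < R₀ ∧ ∀ ξ ∈ frontier Ω, ∀ R, 0 < R → R ≤ R₀ →
      ∫⁻ y in Ω ∩ ball ξ R, ENNReal.ofReal (distBd Ω y ^ (-β)) ≤
        ENNReal.ofReal (C * R ^ ((d : ℝ) - β)) := by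
  obtain ⟨q, ⟨hq0, C, hC, hq⟩, hβq⟩ := exists_mem_lowerCodimSet hβ
  obtain ⟨R₀, hR₀, hdiam⟩ := exists_radius_lt_diam hfr
  have hV := unitBallVol_pos d
  have hb : (1 / 2 : ℝ) ^ (-β + q) < 1 :=
    Real.rpow_lt_one (by norm_num) (by norm_num) (by linarith)
  refine ⟨2 ^ |-β| * C * unitBallVol d * (1 - (1 / 2) ^ (-β + q))⁻¹, R₀,
    mul_nonneg (by positivity) (inv_nonneg.2 (by linarith)), hR₀, fun ξ hξ R hR hRR => ?_⟩
  refine (lintegral_rpow_le_of_sublevel (M := C * unitBallVol d * R ^ ((d : ℝ) - q)) (q := q) hR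
    (by positivity) (by linarith) (fun y hy => ⟨distBd_pos hopen hfr.nonempty hy.1, ?_⟩)
    fun t ht htR => ?_).trans_eq ?_
  · have h1 : distBd Ω y ≤ dist y ξ := infDist_le_dist_of_mem hξ
    exact h1.trans (mem_ball.1 hy.2).le
  · rcases htR.lt_or_eq with htR | rfl
    · calc volume (Ω ∩ ball ξ R ∩ {y | distBd Ω y ≤ t})
          ≤ volume (cthickening t (frontier Ω) ∩ ball ξ R) := by
            refine measure_mono fun y hy => ⟨?_, hy.1.2⟩
            rw [cthickening_frontier_eq hfr.nonempty ht.le]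
            exact hy.2
        _ ≤ ENNReal.ofReal (C * (t / R) ^ q) * volume (ball ξ R) :=
            hq ξ hξ t R ht htR (hdiam R hRR)
        _ = ENNReal.ofReal (C * unitBallVol d * R ^ ((d : ℝ) - q) * t ^ q) := by
            rw [volume_ball_eq ξ hR, ← ENNReal.ofReal_mul (by positivity)]
            congr 1
            rw [Real.div_rpow ht.le hR.le, Real.rpow_sub hR]
            ring
    · calc volume (Ω ∩ ball ξ t ∩ {y | distBd Ω y ≤ t}) ≤ volume (ball ξ t) :=
            measure_mono fun y hy => hy.1.2
        _ = ENNReal.ofReal (unitBallVol d * t ^ (d : ℝ)) := volume_ball_eq ξ ht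
        _ ≤ ENNReal.ofReal (C * unitBallVol d * t ^ ((d : ℝ) - q) * t ^ q) := by
            refine ENNReal.ofReal_le_ofReal ?_
            rw [mul_assoc (C * _), ← Real.rpow_add ht, sub_add_cancel, mul_assoc]
            exact le_mul_of_one_le_left (by positivity) hC
  · congr 1
    rw [show (d : ℝ) - β = ((d : ℝ) - q) + (-β + q) by ring,
      Real.rpow_add hR ((d : ℝ) - q)]
    ring

lemma lintegral_distBd_rpow_lt_top (hopen : IsOpen Ω) (hbdd : Bornology.IsBounded Ω)
    (hfr : (frontier Ω).Nontrivial) {β : ℝ} (hβ0 : 0 ≤ β) (hβ : β < lowerCodimA (frontier Ω)) :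
    ∫⁻ y in Ω, ENNReal.ofReal (distBd Ω y ^ (-β)) < ⊤ := by
  obtain ⟨C, R₀, hC, hR₀, hA⟩ := exists_lintegral_distBd_rpow_ball_le hopen hfr hβ
  have hcpt : IsCompact (frontier Ω) :=
    isCompact_of_isClosed_isBounded isClosed_frontier (hbdd.closure.subset frontier_subset_closure)
  obtain ⟨F, hcov⟩ := hcpt.elim_nhds_subcover' (fun x _ => ball x (R₀ / 2))
    fun x _ => ball_mem_nhds x (by positivity)
  have hsub : Ω ⊆ (Ω ∩ {y | R₀ / 2 ≤ distBd Ω y}) ∪ ⋃ ξ ∈ F, Ω ∩ ball (ξ : Rd d) R₀ := by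
    intro y hy
    rcases le_or_gt (R₀ / 2) (distBd Ω y) with h | h
    · exact Or.inl ⟨hy, h⟩
    · right
      obtain ⟨ζ, hζ, hζy⟩ := exists_frontier_dist_eq hfr.nonempty y
      obtain ⟨ξ, hξ, hζξ⟩ := mem_iUnion₂.1 (hcov hζ)
      refine mem_iUnion₂.2 ⟨ξ, hξ, hy, ?_⟩
      rw [mem_ball] at hζξ ⊢
      linarith [dist_triangle y ζ ξ]
  refine (lintegral_mono_set hsub).trans_lt ((lintegral_union_le _ _ _).trans_lt ?_)
  refine ENNReal.add_lt_top.2 ⟨?_, ?_⟩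
  · calc ∫⁻ y in Ω ∩ {y | R₀ / 2 ≤ distBd Ω y}, ENNReal.ofReal (distBd Ω y ^ (-β))
        ≤ ∫⁻ _ in Ω ∩ {y | R₀ / 2 ≤ distBd Ω y}, ENNReal.ofReal ((R₀ / 2) ^ (-β)) :=
          setLIntegral_mono measurable_const fun y hy => ENNReal.ofReal_le_ofReal
            (Real.rpow_le_rpow_of_nonpos (by positivity) hy.2 (by linarith))
      _ = ENNReal.ofReal ((R₀ / 2) ^ (-β)) * volume (Ω ∩ {y | R₀ / 2 ≤ distBd Ω y}) :=
          setLIntegral_const _ _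
      _ < ⊤ := ENNReal.mul_lt_top ENNReal.ofReal_lt_top
          ((measure_mono inter_subset_left).trans_lt hbdd.measure_lt_top)
  · have : ∀ G : Finset (frontier Ω),
        ∫⁻ y in ⋃ ξ ∈ G, Ω ∩ ball (ξ : Rd d) R₀, ENNReal.ofReal (distBd Ω y ^ (-β)) < ⊤ := by
      intro G
      induction G using Finset.induction_on with
      | empty => simp
      | insert ξ G _ ih =>
        rw [Finset.set_biUnion_insert]
        refine (lintegral_union_le _ _ _).trans_lt (ENNReal.add_lt_top.2 ⟨?_, ih⟩)
        exact (hA ξ ξ.2 R₀ hR₀ le_rfl).trans_lt ENNReal.ofReal_lt_top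
    exact this F

lemma exists_distBd_le (hbdd : Bornology.IsBounded Ω) (hfr : (frontier Ω).Nonempty) :
    ∃ D : ℝ, 0 < D ∧ ∀ x ∈ Ω, distBd Ω x ≤ D := by
  obtain ⟨ξ, hξ⟩ := hfr
  obtain ⟨D, hD⟩ := hbdd.subset_ball ξ
  refine ⟨max D 1, by positivity, fun x hx => ?_⟩
  have h1 : distBd Ω x ≤ dist x ξ := infDist_le_dist_of_mem hξ
  exact h1.trans ((mem_ball.1 (hD hx)).le.trans (le_max_left _ _))

lemma exists_lintegral_kernel_near_le (hopen : IsOpen Ω) (hfr : (frontier Ω).Nonempty)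
    {s p β : ℝ} (hs0 : 0 < s) (hs1 : s < 1) (hp : 1 ≤ p) (hβ0 : 0 ≤ β) :
    ∃ C : ℝ, 0 ≤ C ∧ ∀ x ∈ Ω,
      ∫⁻ y in ball x (distBd Ω x / 2), ENNReal.ofReal (min 1 (4 * dist x y / distBd Ω x) ^ p
        / dist x y ^ ((d : ℝ) + s * p) * distBd Ω y ^ (-β)) ≤
      ENNReal.ofReal (C * distBd Ω x ^ (-(s * p + β))) := by
  have hV := unitBallVol_pos d
  set e : ℝ := p - (d + s * p) with he
  have hpos : 0 < e + d := by rw [he]; nlinarith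
  have hc : 0 ≤ (1 - (1 / 2 : ℝ) ^ (e + d))⁻¹ := inv_nonneg.2
    (sub_nonneg.2 (Real.rpow_le_one (by norm_num) (by norm_num) hpos.le))
  refine ⟨4 ^ p * 2 ^ β * (2 ^ |e| * (unitBallVol d * 2 ^ (d : ℝ)) * (1 / 2) ^ (e + d) *
    (1 - (1 / 2 : ℝ) ^ (e + d))⁻¹), by positivity, fun x hx => ?_⟩
  have hr0 : 0 < distBd Ω x := distBd_pos hopen hfr hx
  set r := distBd Ω x with hr
  have hrad : ∫⁻ y in ball x (r / 2) \ {x}, ENNReal.ofReal (dist x y ^ e) ≤ _ :=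
    lintegral_rpow_le_of_sublevel (μ := volume) (R := r / 2)
      (M := unitBallVol d * 2 ^ (d : ℝ)) (q := d) (by positivity)
      (by positivity) hpos (fun y hy => ⟨dist_pos.2 fun h => hy.2 h.symm,
        by rw [dist_comm]; exact (mem_ball.1 hy.1).le⟩) fun t ht _ => by
      calc volume (ball x (r / 2) \ {x} ∩ {y | dist x y ≤ t})
          ≤ volume (ball x (2 * t)) := measure_mono fun y hy => by
            have : dist x y ≤ t := hy.2
            rw [mem_ball, dist_comm]; linarith
        _ = _ := by
            rw [volume_ball_eq _ (by positivity), Real.mul_rpow zero_le_two ht.le, mul_assoc]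
  have hg_le : ∀ y ∈ ball x (r / 2) \ {x}, ENNReal.ofReal (min 1 (4 * dist x y / r) ^ p
        / dist x y ^ ((d : ℝ) + s * p) * distBd Ω y ^ (-β)) ≤
      ENNReal.ofReal (4 ^ p * 2 ^ β * r ^ (-(p + β))) * ENNReal.ofReal (dist x y ^ e) := by
    intro y hy
    have hxy : 0 < dist x y := dist_pos.2 fun h => hy.2 h.symm
    have hdy : r / 2 ≤ distBd Ω y := by
      have h1 := distBd_le_add (Ω := Ω) x y
      have h2 := mem_ball.1 hy.1
      rw [dist_comm] at h2
      linarith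
    rw [← ENNReal.ofReal_mul (by positivity)]
    refine ENNReal.ofReal_le_ofReal ?_
    calc min 1 (4 * dist x y / r) ^ p / dist x y ^ ((d : ℝ) + s * p) * distBd Ω y ^ (-β)
        ≤ (4 * dist x y / r) ^ p / dist x y ^ ((d : ℝ) + s * p) * (r / 2) ^ (-β) := by
          refine mul_le_mul (div_le_div_of_nonneg_right (Real.rpow_le_rpow (by positivity)
            (min_le_right _ _) (by linarith)) (by positivity))
            (Real.rpow_le_rpow_of_nonpos (by positivity) hdy (by linarith))
            (Real.rpow_nonneg (distBd_nonneg y) _) (by positivity)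
      _ = 4 ^ p * 2 ^ β * r ^ (-(p + β)) * dist x y ^ e := by
          rw [Real.div_rpow (by positivity) hr0.le, Real.mul_rpow (by norm_num) hxy.le,
            Real.div_rpow hr0.le zero_le_two, he, Real.rpow_sub hxy, neg_add, Real.rpow_add hr0,
            Real.rpow_neg zero_le_two, Real.rpow_neg hr0.le p]
          field_simp
  calc _ = ∫⁻ y in ball x (r / 2) \ {x}, ENNReal.ofReal (min 1 (4 * dist x y / r) ^ p
        / dist x y ^ ((d : ℝ) + s * p) * distBd Ω y ^ (-β)) := by
        refine (setLIntegral_congr ?_).symm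
        refine sdiff_null_ae_eq_self (measure_mono_null (t := {x}) subset_rfl ?_)
        have : Nontrivial (Rd d) := by
          obtain ⟨ξ, hξ⟩ := hfr
          refine ⟨x, ξ, fun h => ?_⟩
          rw [hopen.frontier_eq] at hξ
          exact hξ.2 (h ▸ hx)
        exact measure_singleton x
    _ ≤ ∫⁻ y in ball x (r / 2) \ {x}, ENNReal.ofReal (4 ^ p * 2 ^ β * r ^ (-(p + β))) *
        ENNReal.ofReal (dist x y ^ e) := setLIntegral_mono (by fun_prop) hg_le
    _ = ENNReal.ofReal (4 ^ p * 2 ^ β * r ^ (-(p + β))) * ∫⁻ y in ball x (r / 2) \ {x},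
        ENNReal.ofReal (dist x y ^ e) := lintegral_const_mul' _ _ (by simp)
    _ ≤ _ := mul_le_mul_right hrad _
    _ = _ := by
        rw [← ENNReal.ofReal_mul (by positivity)]
        congr 1
        rw [div_eq_mul_one_div r 2, Real.mul_rpow hr0.le (by norm_num),
          show -(s * p + β) = -(p + β) + (e + d) by rw [he]; ring, Real.rpow_add hr0 (-(p + β))]
        ring

lemma exists_lintegral_kernel_mid_le (hopen : IsOpen Ω) (hfr : (frontier Ω).Nontrivial)
    {s p β : ℝ} (hs0 : 0 < s) (hp : 1 ≤ p) (hβ0 : 0 ≤ β) (hβ : β < lowerCodimA (frontier Ω)) :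
    ∃ C T : ℝ, 0 ≤ C ∧ 0 < T ∧ ∀ x ∈ Ω,
      ∫⁻ y in Ω ∩ {y | distBd Ω x / 2 ≤ dist x y ∧ dist x y < T},
        ENNReal.ofReal (min 1 (4 * dist x y / distBd Ω x) ^ p
          / dist x y ^ ((d : ℝ) + s * p) * distBd Ω y ^ (-β)) ≤
      ENNReal.ofReal (C * distBd Ω x ^ (-(s * p + β))) := by
  obtain ⟨C₁, R₀, hC₁, hR₀, hA⟩ := exists_lintegral_distBd_rpow_ball_le hopen hfr hβ
  have hsp : 0 < s * p := by positivity
  have hexp : -((d : ℝ) + s * p) + (d - β) = -(s * p + β) := by ring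
  have hneg : -((d : ℝ) + s * p) + (d - β) < 0 := by linarith
  have hc : 0 ≤ (1 - (2 : ℝ) ^ (-((d : ℝ) + s * p) + (d - β)))⁻¹ := inv_nonneg.2
    (sub_nonneg.2 (Real.rpow_le_one_of_one_le_of_nonpos (by norm_num) hneg.le))
  refine ⟨2 ^ |-((d : ℝ) + s * p)| * (C₁ * 4 ^ ((d : ℝ) - β)) *
    (1 - (2 : ℝ) ^ (-((d : ℝ) + s * p) + (d - β)))⁻¹, R₀ / 8, by positivity, by positivity,
    fun x hx => ?_⟩
  have hr0 : 0 < distBd Ω x := distBd_pos hopen hfr.nonempty hx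
  set r := distBd Ω x with hr
  set S := Ω ∩ {y | r / 2 ≤ dist x y ∧ dist x y < R₀ / 8} with hS
  have hSm : MeasurableSet S := by
    rw [hS, ofPred_and]
    exact hopen.measurableSet.inter ((measurableSet_le measurable_const (by fun_prop)).inter
      (measurableSet_lt (by fun_prop) measurable_const))
  have hw : Measurable fun y => ENNReal.ofReal (distBd Ω y ^ (-β)) := by fun_prop
  set μ := volume.withDensity fun y => ENNReal.ofReal (distBd Ω y ^ (-β)) with hμ
  have hrad : ∫⁻ y in S, ENNReal.ofReal (dist x y ^ (-((d : ℝ) + s * p))) ∂μ ≤ _ :=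
    lintegral_rpow_le_of_superlevel (R := r / 2) (T := R₀ / 8) (M := C₁ * 4 ^ ((d : ℝ) - β))
      (q := d - β) (by positivity) (by positivity) hneg (fun y hy => hy.2) fun t ht htT => by
      have ht0 : 0 < t := by linarith
      obtain ⟨ξ, hξ, hxξ⟩ := exists_frontier_dist_eq hfr.nonempty x
      calc μ (S ∩ {y | dist x y ≤ t}) ≤ μ (Ω ∩ ball ξ (4 * t)) := by
            refine measure_mono fun y hy => ⟨hy.1.1, ?_⟩
            have h1 : dist x y ≤ t := hy.2
            have h2 := dist_triangle y x ξ
            rw [dist_comm y x] at h2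
            rw [mem_ball]
            linarith
        _ = ∫⁻ y in Ω ∩ ball ξ (4 * t), ENNReal.ofReal (distBd Ω y ^ (-β)) :=
            withDensity_apply _ (hopen.measurableSet.inter measurableSet_ball)
        _ ≤ ENNReal.ofReal (C₁ * (4 * t) ^ ((d : ℝ) - β)) :=
            hA ξ hξ (4 * t) (by positivity) (by linarith)
        _ = _ := by rw [Real.mul_rpow (by norm_num) ht0.le, mul_assoc]
  calc _ ≤ ∫⁻ y in S, ENNReal.ofReal (distBd Ω y ^ (-β)) *
        ENNReal.ofReal (dist x y ^ (-((d : ℝ) + s * p))) := by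
        refine setLIntegral_mono (by fun_prop) fun y hy => ?_
        rw [← ENNReal.ofReal_mul (Real.rpow_nonneg (distBd_nonneg y) _),
          mul_comm (distBd Ω y ^ (-β)), Real.rpow_neg dist_nonneg, ← one_div]
        refine ENNReal.ofReal_le_ofReal (mul_le_mul_of_nonneg_right
          (div_le_div_of_nonneg_right ?_ (by positivity)) (Real.rpow_nonneg (distBd_nonneg y) _))
        exact Real.rpow_le_one (by positivity) (min_le_left _ _) (by linarith)
    _ = ∫⁻ y in S, ENNReal.ofReal (dist x y ^ (-((d : ℝ) + s * p))) ∂μ := by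
        rw [hμ, setLIntegral_withDensity_eq_setLIntegral_mul _ hw (by fun_prop) hSm]
        rfl
    _ ≤ _ := hrad
    _ = _ := by
        congr 1
        rw [hexp, show 2 * (r / 2) = r by ring]
        ring

lemma exists_lintegral_kernel_far_le (hopen : IsOpen Ω) (hbdd : Bornology.IsBounded Ω)
    (hfr : (frontier Ω).Nontrivial) {s p β : ℝ} (hs0 : 0 < s) (hp : 1 ≤ p)
    (hβ0 : 0 ≤ β) (hβ : β < lowerCodimA (frontier Ω)) {T : ℝ} (hT : 0 < T) :
    ∃ C : ℝ, 0 ≤ C ∧ ∀ x ∈ Ω,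
      ∫⁻ y in Ω ∩ {y | T ≤ dist x y}, ENNReal.ofReal (min 1 (4 * dist x y / distBd Ω x) ^ p
        / dist x y ^ ((d : ℝ) + s * p) * distBd Ω y ^ (-β)) ≤
      ENNReal.ofReal (C * distBd Ω x ^ (-(s * p + β))) := by
  set W := ∫⁻ y in Ω, ENNReal.ofReal (distBd Ω y ^ (-β)) with hW
  have hWtop : W < ⊤ := lintegral_distBd_rpow_lt_top hopen hbdd hfr hβ0 hβ
  obtain ⟨D, hD0, hD⟩ := exists_distBd_le hbdd hfr.nonempty
  refine ⟨T ^ (-((d : ℝ) + s * p)) * W.toReal * D ^ (s * p + β), by positivity, fun x hx => ?_⟩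
  have hr0 : 0 < distBd Ω x := distBd_pos hopen hfr.nonempty hx
  calc _ ≤ ∫⁻ y in Ω ∩ {y | T ≤ dist x y}, ENNReal.ofReal (T ^ (-((d : ℝ) + s * p))) *
          ENNReal.ofReal (distBd Ω y ^ (-β)) := by
        refine setLIntegral_mono (by fun_prop) fun y hy => ?_
        have hy2 : T ≤ dist x y := hy.2
        have hxy : 0 < dist x y := hT.trans_le hy2
        rw [← ENNReal.ofReal_mul (by positivity)]
        refine ENNReal.ofReal_le_ofReal (mul_le_mul_of_nonneg_right ?_
          (Real.rpow_nonneg (distBd_nonneg y) _))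
        rw [Real.rpow_neg (by positivity), ← one_div]
        exact div_le_div₀ zero_le_one
          (Real.rpow_le_one (by positivity) (min_le_left _ _) (by linarith)) (by positivity)
          (Real.rpow_le_rpow (by positivity) hy2 (by positivity))
    _ ≤ ∫⁻ y in Ω, ENNReal.ofReal (T ^ (-((d : ℝ) + s * p))) *
          ENNReal.ofReal (distBd Ω y ^ (-β)) := lintegral_mono_set inter_subset_left
    _ = ENNReal.ofReal (T ^ (-((d : ℝ) + s * p))) * W := lintegral_const_mul' _ _ (by simp)
    _ = ENNReal.ofReal (T ^ (-((d : ℝ) + s * p)) * W.toReal) := by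
        rw [ENNReal.ofReal_mul (by positivity), ENNReal.ofReal_toReal hWtop.ne]
    _ ≤ _ := by
        refine ENNReal.ofReal_le_ofReal ?_
        rw [mul_assoc _ (D ^ _)]
        refine le_mul_of_one_le_right (by positivity) ?_
        rw [Real.rpow_neg hr0.le, ← div_eq_mul_inv, one_le_div (by positivity)]
        exact Real.rpow_le_rpow hr0.le (hD x hx) (by positivity)

/-- The truncated singular kernel, integrated against a power of the distance to the boundary. -/
lemma exists_lintegral_kernel_le (hopen : IsOpen Ω) (hbdd : Bornology.IsBounded Ω)
    (hfr : (frontier Ω).Nontrivial) {s p β : ℝ} (hs0 : 0 < s) (hs1 : s < 1) (hp : 1 ≤ p)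
    (hβ0 : 0 ≤ β) (hβ : β < lowerCodimA (frontier Ω)) :
    ∃ C : ℝ, 0 ≤ C ∧ ∀ x ∈ Ω,
      ∫⁻ y in Ω, ENNReal.ofReal (min 1 (4 * dist x y / distBd Ω x) ^ p
        / dist x y ^ ((d : ℝ) + s * p) * distBd Ω y ^ (-β)) ≤
      ENNReal.ofReal (C * distBd Ω x ^ (-(s * p + β))) := by
  obtain ⟨K₁, hK₁, hnear⟩ :=
    exists_lintegral_kernel_near_le hopen hfr.nonempty hs0 hs1 hp hβ0
  obtain ⟨K₂, T, hK₂, hT, hmid⟩ := exists_lintegral_kernel_mid_le hopen hfr hs0 hp hβ0 hβ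
  obtain ⟨K₃, hK₃, hfar⟩ := exists_lintegral_kernel_far_le hopen hbdd hfr hs0 hp hβ0 hβ hT
  refine ⟨K₁ + K₂ + K₃, by positivity, fun x hx => ?_⟩
  have hsub : Ω ⊆ ball x (distBd Ω x / 2) ∪
      ((Ω ∩ {y | distBd Ω x / 2 ≤ dist x y ∧ dist x y < T}) ∪ (Ω ∩ {y | T ≤ dist x y})) := by
    intro y hy
    rcases lt_or_ge (dist x y) (distBd Ω x / 2) with h | h
    · exact Or.inl (by rwa [mem_ball, dist_comm])
    · rcases lt_or_ge (dist x y) T with h' | h'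
      · exact Or.inr (Or.inl ⟨hy, h, h'⟩)
      · exact Or.inr (Or.inr ⟨hy, h'⟩)
  have hr : 0 ≤ distBd Ω x ^ (-(s * p + β)) := Real.rpow_nonneg (distBd_nonneg x) _
  refine (lintegral_mono_set hsub).trans ((lintegral_union_le _ _ _).trans ((add_le_add
    (hnear x hx) ((lintegral_union_le _ _ _).trans (add_le_add (hmid x hx) (hfar x hx)))).trans ?_))
  rw [← ENNReal.ofReal_add (by positivity) (by positivity),
    ← ENNReal.ofReal_add (by positivity) (by positivity)]
  exact ENNReal.ofReal_le_ofReal (by linarith)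

end Weights

section Hardy

variable {d : ℕ} {Ω : Set (Rd d)}

lemma exists_corkscrew (hunif : IsUniformDomain Ω) (hfr : (frontier Ω).Nontrivial) :
    ∃ C ρ₀ : ℝ, 1 ≤ C ∧ 0 < ρ₀ ∧ ∀ ξ ∈ frontier Ω, ∀ ρ, 0 < ρ → ρ ≤ ρ₀ →
      ∃ z ∈ Ω, dist z ξ ≤ 2 * ρ ∧ ρ / C ≤ distBd Ω z := by
  obtain ⟨C, hC, hcurve⟩ := hunif
  have hnt : Ω.Nontrivial := by
    by_contra h
    rw [not_nontrivial_iff] at h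
    exact hfr.not_subsingleton (h.closure.anti frontier_subset_closure)
  obtain ⟨a, ha, b, hb, hab⟩ := hnt
  refine ⟨C, dist a b / 4, hC, by have := dist_pos.2 hab; positivity, fun ξ hξ ρ hρ hρ₀ => ?_⟩
  obtain ⟨x, hx, hxξ⟩ := Metric.mem_closure_iff.1 (frontier_subset_closure hξ) ρ hρ
  obtain ⟨w, hw, hxw⟩ : ∃ w ∈ Ω, 2 * ρ ≤ dist x w := by
    by_contra! h
    have h1 := h a ha
    have h2 := h b hb
    have h3 := dist_triangle_left a b x
    linarith
  obtain ⟨l, γ, hl, -, h0, h1, hγΩ, hLip, hdist⟩ := hcurve x hx w hw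
  have hcont : ContinuousOn (fun t => dist (γ t) x) (Icc 0 l) :=
    continuous_dist.comp_continuousOn (hLip.continuousOn.prodMk continuousOn_const)
  obtain ⟨t, ht, htρ⟩ := intermediate_value_Icc hl hcont
    (show ρ ∈ Icc (dist (γ 0) x) (dist (γ l) x) by
      rw [h0, h1, dist_self, dist_comm w]
      exact ⟨hρ.le, by linarith⟩)
  have htρ' : dist (γ t) x = ρ := htρ
  refine ⟨γ t, hγΩ t ht, ?_, le_trans ?_ (hdist t ht)⟩
  · have := dist_triangle (γ t) x ξ
    rw [dist_comm] at hxξ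
    linarith
  · have : ρ ≤ dist (γ t) w := by
      have := dist_triangle_left x w (γ t)
      linarith
    gcongr
    exact le_min htρ'.ge this

/-- If `A` fills a fixed amount of each ball centred in `S`, then `S` is not much larger than
`A`. -/
lemma mul_volume_le_of_le_volume_inter_ball {S A : Set (Rd d)} {ρ : ℝ}
    (hρ : 0 < ρ) {v : ℝ≥0∞} (h : ∀ y ∈ S, v ≤ volume (A ∩ ball y ρ)) :
    v * volume S ≤ ENNReal.ofReal (unitBallVol d * ρ ^ (d : ℝ)) * volume A := by
  have hU : MeasurableSet {z : Rd d × Rd d | dist z.2 z.1 < ρ} :=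
    measurableSet_lt (by fun_prop) measurable_const
  have hF : Measurable ({z : Rd d × Rd d | dist z.2 z.1 < ρ}.indicator (1 : Rd d × Rd d → ℝ≥0∞)) :=
    measurable_one.indicator hU
  have hswap := lintegral_lintegral_swap (μ := volume) (ν := volume.restrict A)
    (f := fun y w => {z : Rd d × Rd d | dist z.2 z.1 < ρ}.indicator (1 : Rd d × Rd d → ℝ≥0∞) (y, w))
    hF.aemeasurable
  calc v * volume S = ∫⁻ _ in S, v := (setLIntegral_const _ _).symm
    _ ≤ ∫⁻ y in S, ∫⁻ w in A, {z : Rd d × Rd d | dist z.2 z.1 < ρ}.indicator 1 (y, w) := by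
        refine setLIntegral_mono hF.lintegral_prod_right' fun y hy => (h y hy).trans_eq ?_
        have : (fun w => {z : Rd d × Rd d | dist z.2 z.1 < ρ}.indicator (1 : Rd d × Rd d → ℝ≥0∞) (y, w)) =
            (ball y ρ).indicator 1 := by
          ext w
          simp [indicator, mem_ball]
        rw [this, lintegral_indicator_one measurableSet_ball,
          Measure.restrict_apply measurableSet_ball, inter_comm]
    _ ≤ ∫⁻ y, ∫⁻ w in A, {z : Rd d × Rd d | dist z.2 z.1 < ρ}.indicator 1 (y, w) :=
        setLIntegral_le_lintegral _ _
    _ = ∫⁻ w in A, ∫⁻ y, {z : Rd d × Rd d | dist z.2 z.1 < ρ}.indicator 1 (y, w) := hswap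
    _ = ∫⁻ _ in A, ENNReal.ofReal (unitBallVol d * ρ ^ (d : ℝ)) := by
        refine lintegral_congr fun w => ?_
        have : (fun y => {z : Rd d × Rd d | dist z.2 z.1 < ρ}.indicator (1 : Rd d × Rd d → ℝ≥0∞) (y, w)) =
            (ball w ρ).indicator 1 := by
          ext y
          simp [indicator, mem_ball, dist_comm]
        rw [this, lintegral_indicator_one measurableSet_ball, volume_ball_eq w hρ]
    _ = _ := setLIntegral_const _ _

/-- The points of `Ω` near `x` whose distance to the boundary is comparable to
`lam * distBd Ω x`. -/
def layer (Ω : Set (Rd d)) (C lam : ℝ) (x : Rd d) : Set (Rd d) :=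
  {w | w ∈ Ω ∧ dist x w ≤ 6 * distBd Ω x ∧ lam * distBd Ω x / C ≤ distBd Ω w ∧
    distBd Ω w ≤ 5 * lam * distBd Ω x}

lemma measurableSet_layer_prod (hopen : IsOpen Ω) (C lam : ℝ) :
    MeasurableSet {z : Rd d × Rd d | z.2 ∈ layer Ω C lam z.1} := by
  have h : {z : Rd d × Rd d | z.2 ∈ layer Ω C lam z.1} = (Prod.snd ⁻¹' Ω) ∩
      ({z | dist z.1 z.2 ≤ 6 * distBd Ω z.1} ∩ ({z | lam * distBd Ω z.1 / C ≤ distBd Ω z.2} ∩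
        {z | distBd Ω z.2 ≤ 5 * lam * distBd Ω z.1})) := by
    ext z
    simp [layer]
    tauto
  rw [h]
  have h1 : Measurable fun z : Rd d × Rd d => distBd Ω z.1 :=
    (measurable_distBd Ω).comp measurable_fst
  have h2 : Measurable fun z : Rd d × Rd d => distBd Ω z.2 :=
    (measurable_distBd Ω).comp measurable_snd
  exact (measurable_snd hopen.measurableSet).inter ((measurableSet_le (by fun_prop)
    (by fun_prop)).inter ((measurableSet_le (by fun_prop) (by fun_prop)).inter
      (measurableSet_le (by fun_prop) (by fun_prop))))

lemma measurableSet_layer (hopen : IsOpen Ω) (C lam : ℝ) (x : Rd d) :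
    MeasurableSet (layer Ω C lam x) :=
  measurable_prodMk_left (x := x) (measurableSet_layer_prod hopen C lam)

lemma exists_volume_layer_ge (hopen : IsOpen Ω) (hunif : IsUniformDomain Ω)
    (hfr : (frontier Ω).Nontrivial) {γ : ℝ} (hγ : upperCodimA (frontier Ω) < γ) :
    ∃ q C c r₀ : ℝ, q < γ ∧ 1 ≤ C ∧ 0 < c ∧ 0 < r₀ ∧ ∀ x ∈ Ω, distBd Ω x ≤ r₀ →
      ∀ lam, 0 < lam → lam < 1 →
        ENNReal.ofReal (c * lam ^ q * distBd Ω x ^ (d : ℝ)) ≤ volume (layer Ω C lam x) := by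
  have hne : {q : ℝ | 0 ≤ q ∧ ∃ c : ℝ, 0 < c ∧ ∀ x ∈ frontier Ω, ∀ r R : ℝ, 0 < r → r < R →
      ENNReal.ofReal R < ediam (frontier Ω) →
      ENNReal.ofReal (c * (r / R) ^ q) * volume (Metric.ball x R)
        ≤ volume (Metric.cthickening r (frontier Ω) ∩ Metric.ball x R)}.Nonempty := by
    refine ⟨d, by positivity, 1, one_pos, fun x hx r R hr hrR _ => ?_⟩
    have hR : 0 < R := hr.trans hrR
    calc ENNReal.ofReal (1 * (r / R) ^ (d : ℝ)) * volume (ball x R) = volume (ball x r) := by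
          rw [volume_ball_eq x hR, volume_ball_eq x hr, ← ENNReal.ofReal_mul (by positivity),
            Real.div_rpow hr.le hR.le]
          congr 1
          field_simp
      _ ≤ volume (cthickening r (frontier Ω) ∩ ball x R) := measure_mono fun y hy => ⟨mem_cthickening_of_dist_le y x r _ hx
          (mem_ball.1 hy).le, ball_subset_ball hrR.le hy⟩
  obtain ⟨q, ⟨-, c, hc, hq⟩, hqγ⟩ := exists_lt_of_csInf_lt hne hγ
  obtain ⟨C, ρ₀, hC, hρ₀, hcork⟩ := exists_corkscrew hunif hfr
  obtain ⟨R₀, hR₀, hdiam⟩ := exists_radius_lt_diam hfr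
  have hV := unitBallVol_pos d
  have hC0 : 0 < C := one_pos.trans_le hC
  refine ⟨q, 2 * C, c * unitBallVol d / (8 * C) ^ (d : ℝ), min R₀ ρ₀, hqγ, by linarith,
    by positivity, by positivity, fun x hx hxr lam hlam hlam1 => ?_⟩
  have hr : 0 < distBd Ω x := distBd_pos hopen hfr.nonempty hx
  obtain ⟨ξ, hξ, hxξ⟩ := exists_frontier_dist_eq hfr.nonempty x
  set r := distBd Ω x with hrdef
  set ρ := lam * r with hρdef
  have hρ : 0 < ρ := by positivity
  have hρr : ρ < r := mul_lt_of_lt_one_left hr hlam1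
  have hthick := hq ξ hξ ρ r hρ hρr (hdiam r (hxr.trans (min_le_left _ _)))
  have hball : ∀ y ∈ cthickening ρ (frontier Ω) ∩ ball ξ r,
      ENNReal.ofReal (unitBallVol d * (ρ / (2 * C)) ^ (d : ℝ)) ≤
        volume (layer Ω (2 * C) lam x ∩ ball y (4 * ρ)) := by
    rintro y ⟨hy, hyξ⟩
    rw [cthickening_frontier_eq hfr.nonempty hρ.le] at hy
    obtain ⟨ζ, hζ, hyζ⟩ := exists_frontier_dist_eq hfr.nonempty y
    have hyρ : dist y ζ ≤ ρ := hyζ ▸ hy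
    obtain ⟨z, hz, hzζ, hdz⟩ := hcork ζ hζ ρ hρ (hρr.le.trans (hxr.trans (min_le_right _ _)))
    rw [← volume_ball_eq z (by positivity)]
    refine measure_mono fun w hw => ?_
    have hw' : dist w z < ρ / (2 * C) := hw
    have hC2 : ρ / (2 * C) = ρ / C / 2 := by field_simp
    have hρC : ρ / C ≤ ρ := div_le_self hρ.le hC
    have hρC0 : 0 < ρ / C := by positivity
    have h1 : distBd Ω w ≤ dist w ζ := infDist_le_dist_of_mem hζ
    have h2 := dist_triangle w z ζ
    have h3 := distBd_le_add (Ω := Ω) z w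
    have h4 := dist_triangle w ζ y
    have h5 := dist_triangle4 x ξ y w
    rw [mem_ball] at hyξ
    rw [dist_comm z w] at h3
    rw [dist_comm ζ y] at h4
    rw [dist_comm ξ y, dist_comm y w] at h5
    refine ⟨⟨ball_distBd_subset hopen hz (mem_ball.2 (by linarith)), by linarith, ?_, ?_⟩, ?_⟩
    · linarith
    · rw [mul_assoc]
      linarith
    · rw [mem_ball]
      linarith
  have hcov := mul_volume_le_of_le_volume_inter_ball (by positivity) hball
  have hle : volume (cthickening ρ (frontier Ω) ∩ ball ξ r) ≤
      ENNReal.ofReal ((8 * C) ^ (d : ℝ)) * volume (layer Ω (2 * C) lam x) := by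
    have heq : unitBallVol d * (4 * ρ) ^ (d : ℝ) =
        unitBallVol d * (ρ / (2 * C)) ^ (d : ℝ) * (8 * C) ^ (d : ℝ) := by
      rw [mul_assoc, ← Real.mul_rpow (by positivity) (by positivity)]
      congr 2
      field_simp
      norm_num
    have hpos : 0 < unitBallVol d * (ρ / (2 * C)) ^ (d : ℝ) := by positivity
    rw [heq, ENNReal.ofReal_mul (p := unitBallVol d * (ρ / (2 * C)) ^ (d : ℝ))
      (q := (8 * C) ^ (d : ℝ)) hpos.le, mul_assoc] at hcov
    exact (ENNReal.mul_le_mul_iff_right (ENNReal.ofReal_pos.2 hpos).ne'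
      ENNReal.ofReal_ne_top).1 hcov
  have hC8 : 0 < (8 * C) ^ (d : ℝ) := by positivity
  refine (ENNReal.mul_le_mul_iff_right (a := ENNReal.ofReal ((8 * C) ^ (d : ℝ)))
    (by simpa using hC8) (by simp)).1 (le_trans (le_of_eq ?_) (hthick.trans hle))
  rw [volume_ball_eq ξ hr, ← ENNReal.ofReal_mul (by positivity),
    ← ENNReal.ofReal_mul (by positivity), hρdef, mul_div_cancel_right₀ _ hr.ne']
  congr 1
  field_simp

end Hardy

section HardyInequality

variable {d : ℕ} {Ω : Set (Rd d)}

lemma abs_rpow_mul_distBd_le_of_mem_layer {s p α β C lam : ℝ} (hopen : IsOpen Ω)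
    (hfr : (frontier Ω).Nonempty) (hs0 : 0 < s) (hp : 1 ≤ p) (hβ0 : 0 ≤ β)
    (hlam : lam ≤ 1 / 5) {x w : Rd d} (hx : x ∈ Ω) (hw : w ∈ layer Ω C lam x)
    (φ : Rd d → ℝ) :
    |φ x| ^ p * distBd Ω x ^ (-(s * p + α + β + d)) ≤
      2 ^ p * 6 ^ ((d : ℝ) + s * p) * (|φ x - φ w| ^ p / dist x w ^ ((d : ℝ) + s * p)
        * distBd Ω w ^ (-β) * distBd Ω x ^ (-α)) +
      2 ^ p * |φ w| ^ p * distBd Ω x ^ (-(s * p + α + β + d)) := by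
  obtain ⟨hwΩ, hdist, -, hwx⟩ := hw
  have hdx : 0 < distBd Ω x := distBd_pos hopen hfr hx
  have hdw : 0 < distBd Ω w := distBd_pos hopen hfr hwΩ
  have hdwx : distBd Ω w ≤ distBd Ω x := by nlinarith
  have hkey : |φ x - φ w| ^ p * distBd Ω x ^ (-(s * p + α + β + d)) ≤
      6 ^ ((d : ℝ) + s * p) * (|φ x - φ w| ^ p / dist x w ^ ((d : ℝ) + s * p)
        * distBd Ω w ^ (-β) * distBd Ω x ^ (-α)) := by
    rcases eq_or_ne x w with rfl | hne
    · simp [Real.zero_rpow (by linarith : p ≠ 0)]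
    have hpos : 0 < dist x w := dist_pos.2 hne
    have he : 0 ≤ (d : ℝ) + s * p := by positivity
    have h1 : distBd Ω x ^ (-((d : ℝ) + s * p)) ≤
        6 ^ ((d : ℝ) + s * p) / dist x w ^ ((d : ℝ) + s * p) := by
      rw [Real.rpow_neg hdx.le, ← Real.div_rpow (by norm_num) hpos.le,
        ← Real.inv_rpow hdx.le]
      refine Real.rpow_le_rpow (by positivity) ?_ he
      rw [inv_eq_one_div, div_le_div_iff₀ hdx hpos]
      linarith
    have h2 : distBd Ω x ^ (-β) ≤ distBd Ω w ^ (-β) :=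
      Real.rpow_le_rpow_of_nonpos hdw hdwx (by linarith)
    have h3 : distBd Ω x ^ (-(s * p + α + β + d)) =
        distBd Ω x ^ (-((d : ℝ) + s * p)) * distBd Ω x ^ (-β) * distBd Ω x ^ (-α) := by
      rw [← Real.rpow_add hdx, ← Real.rpow_add hdx]
      congr 1
      ring
    rw [h3]
    calc |φ x - φ w| ^ p *
          (distBd Ω x ^ (-((d : ℝ) + s * p)) * distBd Ω x ^ (-β) * distBd Ω x ^ (-α))
        ≤ |φ x - φ w| ^ p * (6 ^ ((d : ℝ) + s * p) / dist x w ^ ((d : ℝ) + s * p) *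
          distBd Ω w ^ (-β) * distBd Ω x ^ (-α)) := by gcongr
      _ = _ := by ring
  have hsum := abs_add_rpow_le (by linarith : 0 ≤ p) (φ x - φ w) (φ w)
  rw [sub_add_cancel] at hsum
  calc |φ x| ^ p * distBd Ω x ^ (-(s * p + α + β + d))
      ≤ 2 ^ p * (|φ x - φ w| ^ p + |φ w| ^ p) * distBd Ω x ^ (-(s * p + α + β + d)) := by
        gcongr
    _ = 2 ^ p * (|φ x - φ w| ^ p * distBd Ω x ^ (-(s * p + α + β + d))) +
        2 ^ p * |φ w| ^ p * distBd Ω x ^ (-(s * p + α + β + d)) := by ring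
    _ ≤ 2 ^ p * (6 ^ ((d : ℝ) + s * p) * (|φ x - φ w| ^ p / dist x w ^ ((d : ℝ) + s * p)
        * distBd Ω w ^ (-β) * distBd Ω x ^ (-α))) +
        2 ^ p * |φ w| ^ p * distBd Ω x ^ (-(s * p + α + β + d)) := by gcongr
    _ = _ := by ring

lemma lintegral_layer_fiber_le {γ C lam : ℝ} (hopen : IsOpen Ω)
    (hfr : (frontier Ω).Nonempty) (hγ : 0 ≤ γ) (hC : 1 ≤ C) (hlam : 0 < lam)
    {w : Rd d} (hw : w ∈ Ω) :
    ∫⁻ x in Ω, {z : Rd d × Rd d | z.2 ∈ layer Ω C lam z.1}.indicator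
        (fun z => ENNReal.ofReal (distBd Ω z.1 ^ (-(γ + d)))) (x, w) ≤
      ENNReal.ofReal (unitBallVol d * (7 * C) ^ (d : ℝ) * 5 ^ (γ + d) * lam ^ γ *
        distBd Ω w ^ (-γ)) := by
  have hdw : 0 < distBd Ω w := distBd_pos hopen hfr hw
  have hC0 : 0 < C := by linarith
  set R := 7 * C * distBd Ω w / lam with hR
  have hRpos : 0 < R := by positivity
  have hle : ∀ x ∈ Ω, {z : Rd d × Rd d | z.2 ∈ layer Ω C lam z.1}.indicator
        (fun z => ENNReal.ofReal (distBd Ω z.1 ^ (-(γ + d)))) (x, w) ≤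
      (ball w R).indicator
        (fun _ => ENNReal.ofReal ((distBd Ω w / (5 * lam)) ^ (-(γ + d)))) x := by
    intro x hx
    have hdx : 0 < distBd Ω x := distBd_pos hopen hfr hx
    by_cases hxw : w ∈ layer Ω C lam x
    · have hmem : (x, w) ∈ {z : Rd d × Rd d | z.2 ∈ layer Ω C lam z.1} := hxw
      obtain ⟨-, h1, h2, h3⟩ := hxw
      have hball : x ∈ ball w R := by
        rw [mem_ball, hR, lt_div_iff₀ hlam]
        rw [div_le_iff₀ hC0] at h2
        have : 0 < C * distBd Ω w := by positivity
        nlinarith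
      rw [indicator_of_mem hmem, indicator_of_mem hball]
      refine ENNReal.ofReal_le_ofReal (Real.rpow_le_rpow_of_nonpos (by positivity) ?_ ?_)
      · rw [div_le_iff₀ (by positivity)]
        linarith
      · have : 0 ≤ γ + d := by positivity
        linarith
    · rw [indicator_of_notMem (by exact hxw)]
      exact zero_le
  calc _ ≤ ∫⁻ x in Ω, (ball w R).indicator
        (fun _ => ENNReal.ofReal ((distBd Ω w / (5 * lam)) ^ (-(γ + d)))) x :=
        setLIntegral_mono (measurable_const.indicator measurableSet_ball) hle
    _ ≤ ∫⁻ x, (ball w R).indicator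
        (fun _ => ENNReal.ofReal ((distBd Ω w / (5 * lam)) ^ (-(γ + d)))) x :=
        setLIntegral_le_lintegral _ _
    _ = ENNReal.ofReal ((distBd Ω w / (5 * lam)) ^ (-(γ + d))) *
        ENNReal.ofReal (unitBallVol d * R ^ (d : ℝ)) := by
        rw [lintegral_indicator_const measurableSet_ball, volume_ball_eq w hRpos]
    _ = _ := by
        rw [← ENNReal.ofReal_mul (by positivity)]
        congr 1
        rw [hR, Real.div_rpow (by positivity) hlam.le, Real.mul_rpow (by positivity) hdw.le,
          Real.rpow_neg (by positivity), ← Real.inv_rpow (by positivity), inv_div,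
          Real.div_rpow (by positivity) hdw.le, Real.mul_rpow (by norm_num) hlam.le,
          Real.rpow_add hlam γ d, Real.rpow_add hdw γ d, Real.rpow_neg hdw.le]
        have := (Real.rpow_pos_of_pos hlam (d : ℝ)).ne'
        have := (Real.rpow_pos_of_pos hdw (d : ℝ)).ne'
        have := (Real.rpow_pos_of_pos hdw γ).ne'
        field_simp

lemma le_two_mul_of_le_add_half {a c I X : ℝ≥0∞} (hI : I ≠ ⊤) (hc : 2 * c ≤ a)
    (hca : c ≠ ⊤) (h : a * I ≤ X + c * I) : a * I ≤ 2 * X := by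
  have h1 : 2 * (c * I) ≤ a * I := by
    rw [← mul_assoc]
    gcongr
  have h2 : c * I ≤ X := by
    have h3 := h1.trans h
    rw [two_mul] at h3
    exact (ENNReal.add_le_add_iff_right (ENNReal.mul_ne_top hca hI)).1 h3
  calc a * I ≤ X + c * I := h
    _ ≤ X + X := by gcongr
    _ = 2 * X := (two_mul X).symm

lemma exists_pos_le_mul_rpow_le {q γ K c : ℝ} (hq : q < γ) (hK : 0 < K) (hc : 0 < c) :
    ∃ lam : ℝ, 0 < lam ∧ lam ≤ 1 / 5 ∧ 2 * (K * lam ^ γ) ≤ c * lam ^ q := by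
  have hpos : 0 < c / (2 * K) := by positivity
  have he : 0 < γ - q := by linarith
  set lam := min (1 / 5) ((c / (2 * K)) ^ (γ - q)⁻¹) with hlam
  have h0 : 0 < lam := lt_min (by norm_num) (by positivity)
  refine ⟨lam, h0, min_le_left _ _, ?_⟩
  have h1 : lam ^ (γ - q) ≤ c / (2 * K) := by
    calc lam ^ (γ - q) ≤ ((c / (2 * K)) ^ (γ - q)⁻¹) ^ (γ - q) :=
          Real.rpow_le_rpow h0.le (min_le_right _ _) he.le
      _ = _ := Real.rpow_inv_rpow hpos.le he.ne'
  have h2 : lam ^ γ = lam ^ (γ - q) * lam ^ q := by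
    rw [← Real.rpow_add h0, sub_add_cancel]
  rw [le_div_iff₀ (by positivity)] at h1
  have h3 : 0 < lam ^ q := by positivity
  rw [h2]
  nlinarith

end HardyInequality

section HardyInequality

variable {d : ℕ} {Ω : Set (Rd d)}

lemma measurable_gagP_integrand {s p α β : ℝ} {φ : Rd d → ℝ} (hφ : Measurable φ) :
    Measurable fun z : Rd d × Rd d => ENNReal.ofReal
      (|φ z.1 - φ z.2| ^ p / dist z.1 z.2 ^ ((d : ℝ) + s * p)
        * distBd Ω z.2 ^ (-β) * distBd Ω z.1 ^ (-α)) := by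
  have h1 : Measurable fun z : Rd d × Rd d => distBd Ω z.1 :=
    (measurable_distBd Ω).comp measurable_fst
  have h2 : Measurable fun z : Rd d × Rd d => distBd Ω z.2 :=
    (measurable_distBd Ω).comp measurable_snd
  have h3 : Measurable fun z : Rd d × Rd d => |φ z.1 - φ z.2| :=
    ((hφ.comp measurable_fst).sub (hφ.comp measurable_snd)).abs
  fun_prop

lemma mul_abs_rpow_mul_distBd_le {s p α β C lam q c r₀ : ℝ} (hopen : IsOpen Ω)
    (hfr : (frontier Ω).Nonempty) (hs0 : 0 < s) (hp : 1 ≤ p) (hβ0 : 0 ≤ β)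
    (hlam0 : 0 < lam) (hlam : lam ≤ 1 / 5) (hc : 0 < c)
    (hvol : ∀ x ∈ Ω, distBd Ω x ≤ r₀ →
      ENNReal.ofReal (c * lam ^ q * distBd Ω x ^ (d : ℝ)) ≤ volume (layer Ω C lam x))
    {φ : Rd d → ℝ} (hφ : Measurable φ) {x : Rd d} (hx : x ∈ Ω) (hxr : distBd Ω x ≤ r₀) :
    ENNReal.ofReal (c * lam ^ q) *
        ENNReal.ofReal (|φ x| ^ p * distBd Ω x ^ (-(s * p + α + β))) ≤
      ENNReal.ofReal (2 ^ p * 6 ^ ((d : ℝ) + s * p)) *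
        (∫⁻ w in Ω, ENNReal.ofReal (|φ x - φ w| ^ p / dist x w ^ ((d : ℝ) + s * p)
          * distBd Ω w ^ (-β) * distBd Ω x ^ (-α))) +
      ∫⁻ w in Ω, ENNReal.ofReal (2 ^ p * |φ w| ^ p) *
        {z : Rd d × Rd d | z.2 ∈ layer Ω C lam z.1}.indicator
          (fun z => ENNReal.ofReal (distBd Ω z.1 ^ (-(s * p + α + β + d)))) (x, w) := by
  have hdx : 0 < distBd Ω x := distBd_pos hopen hfr hx
  have hL := measurableSet_layer hopen C lam x
  have hmeas : Measurable fun w => ENNReal.ofReal (|φ x - φ w| ^ p /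
      dist x w ^ ((d : ℝ) + s * p) * distBd Ω w ^ (-β) * distBd Ω x ^ (-α)) := by
    have : Measurable fun w => |φ x - φ w| := (measurable_const.sub hφ).abs
    fun_prop
  calc ENNReal.ofReal (c * lam ^ q) *
        ENNReal.ofReal (|φ x| ^ p * distBd Ω x ^ (-(s * p + α + β)))
      = ENNReal.ofReal (|φ x| ^ p * distBd Ω x ^ (-(s * p + α + β + d))) *
        ENNReal.ofReal (c * lam ^ q * distBd Ω x ^ (d : ℝ)) := by
        rw [← ENNReal.ofReal_mul (by positivity), ← ENNReal.ofReal_mul (by positivity)]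
        congr 1
        have : distBd Ω x ^ (-(s * p + α + β)) =
            distBd Ω x ^ (-(s * p + α + β + d)) * distBd Ω x ^ (d : ℝ) := by
          rw [← Real.rpow_add hdx]
          congr 1
          ring
        rw [this]
        ring
    _ ≤ ENNReal.ofReal (|φ x| ^ p * distBd Ω x ^ (-(s * p + α + β + d))) *
        volume (layer Ω C lam x) := by
        gcongr
        exact hvol x hx hxr
    _ = ∫⁻ w in Ω, (layer Ω C lam x).indicator
        (fun _ => ENNReal.ofReal (|φ x| ^ p * distBd Ω x ^ (-(s * p + α + β + d)))) w := by
        rw [lintegral_indicator_const hL, Measure.restrict_apply hL,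
          inter_eq_self_of_subset_left fun w hw => hw.1]
    _ ≤ ∫⁻ w in Ω, (ENNReal.ofReal (2 ^ p * 6 ^ ((d : ℝ) + s * p)) *
        ENNReal.ofReal (|φ x - φ w| ^ p / dist x w ^ ((d : ℝ) + s * p)
          * distBd Ω w ^ (-β) * distBd Ω x ^ (-α)) +
        ENNReal.ofReal (2 ^ p * |φ w| ^ p) *
          {z : Rd d × Rd d | z.2 ∈ layer Ω C lam z.1}.indicator
            (fun z => ENNReal.ofReal (distBd Ω z.1 ^ (-(s * p + α + β + d)))) (x, w)) := by
        refine lintegral_mono fun w => ?_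
        by_cases hw : w ∈ layer Ω C lam x
        · have hmem : (x, w) ∈ {z : Rd d × Rd d | z.2 ∈ layer Ω C lam z.1} := hw
          have hdw : 0 < distBd Ω w := distBd_pos hopen hfr hw.1
          rw [indicator_of_mem hw, indicator_of_mem hmem, ← ENNReal.ofReal_mul (by positivity),
            ← ENNReal.ofReal_mul (by positivity), ← ENNReal.ofReal_add (by positivity)
              (by positivity)]
          exact ENNReal.ofReal_le_ofReal
            (abs_rpow_mul_distBd_le_of_mem_layer hopen hfr hs0 hp hβ0 hlam hx hw φ)
        · rw [indicator_of_notMem hw]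
          exact zero_le
    _ = _ := by
        rw [lintegral_add_left (hmeas.const_mul _), lintegral_const_mul _ hmeas]

/-- A fractional Hardy inequality for functions whose Hardy integral is already known to be
finite. -/
lemma exists_hardy_inequality (hopen : IsOpen Ω) (hunif : IsUniformDomain Ω)
    (hfr : (frontier Ω).Nontrivial) {s p α β : ℝ} (hs0 : 0 < s) (hp : 1 ≤ p) (hα0 : 0 ≤ α)
    (hβ0 : 0 ≤ β) (h : upperCodimA (frontier Ω) < s * p + α + β) :
    ∃ K : ℝ≥0∞, K ≠ ⊤ ∧ ∀ φ : Rd d → ℝ, Measurable φ →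
      (∫⁻ x in Ω, ENNReal.ofReal (|φ x| ^ p * distBd Ω x ^ (-(s * p + α + β)))) ≠ ⊤ →
      ∫⁻ x in Ω, ENNReal.ofReal (|φ x| ^ p * distBd Ω x ^ (-(s * p + α + β))) ≤
        K * ((∫⁻ x in Ω, ENNReal.ofReal (|φ x| ^ p)) + gagP Ω s p α β φ) := by
  obtain ⟨q, C, c, r₀, hq, hC, hc, hr₀, hvol⟩ := exists_volume_layer_ge hopen hunif hfr h
  have hC0 : 0 < C := by linarith
  have hV := unitBallVol_pos d
  set γ := s * p + α + β with hγ
  have hγ0 : 0 ≤ γ := by positivity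
  set K2 : ℝ := 2 ^ p * (unitBallVol d * (7 * C) ^ (d : ℝ) * 5 ^ (γ + d)) with hK2
  have hK2pos : 0 < K2 := by positivity
  obtain ⟨lam, hlam0, hlam5, hlam⟩ := exists_pos_le_mul_rpow_le hq hK2pos hc
  set a := ENNReal.ofReal (c * lam ^ q) with ha
  have ha0 : a ≠ 0 := (ENNReal.ofReal_pos.2 (by positivity)).ne'
  have hat : a ≠ ⊤ := ENNReal.ofReal_ne_top
  set K1 := ENNReal.ofReal (2 ^ p * 6 ^ ((d : ℝ) + s * p)) with hK1
  set K3 := ENNReal.ofReal (r₀ ^ (-γ)) with hK3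
  refine ⟨a⁻¹ * (2 * (K1 + a * K3)), ?_, fun φ hφ hI => ?_⟩
  · exact ENNReal.mul_ne_top (ENNReal.inv_ne_top.2 ha0) (ENNReal.mul_ne_top (by simp)
      (ENNReal.add_ne_top.2 ⟨ENNReal.ofReal_ne_top, ENNReal.mul_ne_top hat
        ENNReal.ofReal_ne_top⟩))
  set I := ∫⁻ x in Ω, ENNReal.ofReal (|φ x| ^ p * distBd Ω x ^ (-γ)) with hIdef
  set L := ∫⁻ x in Ω, ENNReal.ofReal (|φ x| ^ p) with hLdef
  set T := {z : Rd d × Rd d | z.2 ∈ layer Ω C lam z.1} with hT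
  have hTm : MeasurableSet T := measurableSet_layer_prod hopen C lam
  have hd1 : Measurable fun z : Rd d × Rd d => distBd Ω z.1 :=
    (measurable_distBd Ω).comp measurable_fst
  have hFm : Measurable (T.indicator
      (fun z => ENNReal.ofReal (distBd Ω z.1 ^ (-(γ + d))))) :=
    Measurable.indicator (by fun_prop) hTm
  have hGm : Measurable fun z : Rd d × Rd d => ENNReal.ofReal (2 ^ p * |φ z.2| ^ p) *
      T.indicator (fun z => ENNReal.ofReal (distBd Ω z.1 ^ (-(γ + d)))) z := by
    refine Measurable.mul ?_ hFm
    have : Measurable fun z : Rd d × Rd d => φ z.2 := hφ.comp measurable_snd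
    fun_prop
  have hgm := measurable_gagP_integrand (Ω := Ω) (s := s) (p := p) (α := α) (β := β) hφ
  have hpt : ∀ x ∈ Ω, a * ENNReal.ofReal (|φ x| ^ p * distBd Ω x ^ (-γ)) ≤
      K1 * (∫⁻ w in Ω, ENNReal.ofReal (|φ x - φ w| ^ p / dist x w ^ ((d : ℝ) + s * p)
          * distBd Ω w ^ (-β) * distBd Ω x ^ (-α))) +
      (∫⁻ w in Ω, ENNReal.ofReal (2 ^ p * |φ w| ^ p) *
        T.indicator (fun z => ENNReal.ofReal (distBd Ω z.1 ^ (-(γ + d)))) (x, w)) +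
      a * K3 * ENNReal.ofReal (|φ x| ^ p) := by
    intro x hx
    rcases le_total (distBd Ω x) r₀ with hxr | hxr
    · refine le_trans ?_ le_self_add
      exact mul_abs_rpow_mul_distBd_le hopen hfr.nonempty hs0 hp hβ0 hlam0 hlam5 hc
        (fun x hx hxr => hvol x hx hxr lam hlam0 (by linarith)) hφ hx hxr
    · refine le_trans ?_ le_add_self
      rw [mul_assoc]
      gcongr
      rw [hK3, ← ENNReal.ofReal_mul (by positivity), mul_comm]
      refine ENNReal.ofReal_le_ofReal ?_
      gcongr ?_ * _
      exact Real.rpow_le_rpow_of_nonpos hr₀ hxr (by linarith)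
  have hmain : a * I ≤ (K1 * gagP Ω s p α β φ + a * K3 * L) +
      ENNReal.ofReal (K2 * lam ^ γ) * I := by
    calc a * I = ∫⁻ x in Ω, a * ENNReal.ofReal (|φ x| ^ p * distBd Ω x ^ (-γ)) :=
          (lintegral_const_mul _ (by fun_prop)).symm
      _ ≤ ∫⁻ x in Ω, (K1 * (∫⁻ w in Ω, ENNReal.ofReal (|φ x - φ w| ^ p /
          dist x w ^ ((d : ℝ) + s * p) * distBd Ω w ^ (-β) * distBd Ω x ^ (-α))) +
          (∫⁻ w in Ω, ENNReal.ofReal (2 ^ p * |φ w| ^ p) *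
            T.indicator (fun z => ENNReal.ofReal (distBd Ω z.1 ^ (-(γ + d)))) (x, w)) +
          a * K3 * ENNReal.ofReal (|φ x| ^ p)) :=
          setLIntegral_mono (((hgm.lintegral_prod_right'.const_mul _).add
            hGm.lintegral_prod_right').add (by fun_prop)) hpt
      _ = K1 * gagP Ω s p α β φ +
          (∫⁻ x in Ω, ∫⁻ w in Ω, ENNReal.ofReal (2 ^ p * |φ w| ^ p) *
            T.indicator (fun z => ENNReal.ofReal (distBd Ω z.1 ^ (-(γ + d)))) (x, w)) +
          a * K3 * L := by
          rw [lintegral_add_right _ (by fun_prop), lintegral_add_left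
            (hgm.lintegral_prod_right'.const_mul _), lintegral_const_mul _
            hgm.lintegral_prod_right', lintegral_const_mul _ (by fun_prop)]
          rfl
      _ ≤ K1 * gagP Ω s p α β φ + ENNReal.ofReal (K2 * lam ^ γ) * I + a * K3 * L := by
          gcongr
          rw [lintegral_lintegral_swap hGm.aemeasurable, ← lintegral_const_mul _ (by fun_prop)]
          refine setLIntegral_mono (by fun_prop) fun w hw => ?_
          have hdw : 0 < distBd Ω w := distBd_pos hopen hfr.nonempty hw
          have hFw : Measurable fun x => T.indicator
              (fun z => ENNReal.ofReal (distBd Ω z.1 ^ (-(γ + d)))) (x, w) :=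
            hFm.comp measurable_prodMk_right
          rw [lintegral_const_mul _ hFw]
          calc _ ≤ ENNReal.ofReal (2 ^ p * |φ w| ^ p) * ENNReal.ofReal (unitBallVol d *
                (7 * C) ^ (d : ℝ) * 5 ^ (γ + d) * lam ^ γ * distBd Ω w ^ (-γ)) := by
                gcongr
                exact lintegral_layer_fiber_le hopen hfr.nonempty hγ0 hC hlam0 hw
            _ = _ := by
                rw [← ENNReal.ofReal_mul (by positivity), ← ENNReal.ofReal_mul (by positivity)]
                congr 1
                ring
      _ = _ := by ring
  have habs := le_two_mul_of_le_add_half hI (a := a) (c := ENNReal.ofReal (K2 * lam ^ γ)) (by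
    rw [← ENNReal.ofReal_ofNat 2, ← ENNReal.ofReal_mul (by norm_num)]
    exact ENNReal.ofReal_le_ofReal hlam) ENNReal.ofReal_ne_top hmain
  calc I = a⁻¹ * (a * I) := by rw [← mul_assoc, ENNReal.inv_mul_cancel ha0 hat, one_mul]
    _ ≤ a⁻¹ * (2 * (K1 * gagP Ω s p α β φ + a * K3 * L)) := by gcongr
    _ ≤ a⁻¹ * (2 * ((K1 + a * K3) * (L + gagP Ω s p α β φ))) := by
        gcongr
        rw [add_mul]
        gcongr
        · exact le_add_self
        · exact le_self_add
    _ = _ := by ring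

end HardyInequality

section Necessity

variable {d : ℕ} {Ω : Set (Rd d)} {s p α β : ℝ}

/-- The `p`-th powers of the `L^p` norm and of the Gagliardo seminorm, added up. -/
noncomputable def energy (Ω : Set (Rd d)) (s p α β : ℝ) (f : Rd d → ℝ) : ℝ≥0∞ :=
  (∫⁻ x in Ω, ENNReal.ofReal (|f x| ^ p)) + gagP Ω s p α β f

lemma gagP_congr_ae {f g : Rd d → ℝ} (h : f =ᵐ[volume.restrict Ω] g) :
    gagP Ω s p α β f = gagP Ω s p α β g := by
  refine lintegral_congr_ae ?_
  filter_upwards [h] with x hx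
  refine lintegral_congr_ae ?_
  filter_upwards [h] with y hy
  rw [hx, hy]

lemma memW_congr_ae {f g : Rd d → ℝ} (h : f =ᵐ[volume.restrict Ω] g) :
    memW Ω s p α β f ↔ memW Ω s p α β g := by
  rw [memW, memW, gagP_congr_ae h, memLp_congr_ae h]

lemma memW0_congr_ae {f g : Rd d → ℝ} (h : f =ᵐ[volume.restrict Ω] g) :
    memW0 Ω s p α β f ↔ memW0 Ω s p α β g := by
  have hsub : ∀ φ : Rd d → ℝ, wNorm Ω s p α β (fun x => f x - φ x) =
      wNorm Ω s p α β (fun x => g x - φ x) := by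
    intro φ
    have h' : (fun x => f x - φ x) =ᵐ[volume.restrict Ω] fun x => g x - φ x := by
      filter_upwards [h] with x hx
      rw [hx]
    rw [wNorm, wNorm, gagSemi, gagSemi, gagP_congr_ae h', eLpNorm_congr_ae h']
  simp only [memW0, memW_congr_ae h, hsub]

lemma eLpNorm_eq_lintegral_abs_rpow {X : Type*} [MeasurableSpace X] (hp : 1 ≤ p) (f : X → ℝ)
    (μ : Measure X) :
    eLpNorm f (ENNReal.ofReal p) μ = (∫⁻ x, ENNReal.ofReal (|f x| ^ p) ∂μ) ^ (1 / p) := by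
  have hp0 : 0 < p := by linarith
  rw [eLpNorm_eq_lintegral_rpow_enorm_toReal (by simpa using hp0) ENNReal.ofReal_ne_top,
    ENNReal.toReal_ofReal hp0.le]
  congr 1
  refine lintegral_congr fun x => ?_
  rw [Real.enorm_eq_ofReal_abs, ENNReal.ofReal_rpow_of_nonneg (abs_nonneg _) hp0.le]

lemma memW_iff_energy_lt_top (hp : 1 ≤ p) {f : Rd d → ℝ} (hf : Measurable f) :
    memW Ω s p α β f ↔ energy Ω s p α β f < ⊤ := by
  have hp0 : 0 < p := by linarith
  rw [memW, energy, ENNReal.add_lt_top, MemLp, eLpNorm_eq_lintegral_abs_rpow hp,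
    ENNReal.rpow_lt_top_iff_of_pos (by positivity)]
  simp [hf.aestronglyMeasurable]

lemma lintegral_abs_rpow_le_of_wNorm_lt (hp : 1 ≤ p) {f : Rd d → ℝ} {ε : ℝ≥0∞}
    (h : wNorm Ω s p α β f < ε) : ∫⁻ x in Ω, ENNReal.ofReal (|f x| ^ p) ≤ ε ^ p := by
  have hp0 : 0 < p := by linarith
  have h1 : eLpNorm f (ENNReal.ofReal p) (volume.restrict Ω) ≤ ε := le_self_add.trans h.le
  rw [eLpNorm_eq_lintegral_abs_rpow hp, one_div] at h1
  exact (ENNReal.rpow_inv_le_iff hp0).1 h1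

lemma gagP_le_of_wNorm_lt (hp : 1 ≤ p) {f : Rd d → ℝ} {ε : ℝ≥0∞}
    (h : wNorm Ω s p α β f < ε) : gagP Ω s p α β f ≤ ε ^ p := by
  have hp0 : 0 < p := by linarith
  have h1 : gagSemi Ω s p α β f ≤ ε := le_add_self.trans h.le
  rw [gagSemi, one_div] at h1
  exact (ENNReal.rpow_inv_le_iff hp0).1 h1

lemma ofReal_abs_add_rpow_le (hp : 1 ≤ p) (a b : ℝ) :
    ENNReal.ofReal (|a + b| ^ p) ≤
      ENNReal.ofReal (2 ^ p) * (ENNReal.ofReal (|a| ^ p) + ENNReal.ofReal (|b| ^ p)) := by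
  rw [← ENNReal.ofReal_add (by positivity) (by positivity),
    ← ENNReal.ofReal_mul (by positivity)]
  exact ENNReal.ofReal_le_ofReal (abs_add_rpow_le (by linarith) a b)

lemma gagP_integrand_add_le (hp : 1 ≤ p) {f g : Rd d → ℝ} (x y : Rd d) :
    ENNReal.ofReal (|f x + g x - (f y + g y)| ^ p / dist x y ^ ((d : ℝ) + s * p)
      * distBd Ω y ^ (-β) * distBd Ω x ^ (-α)) ≤
    ENNReal.ofReal (2 ^ p) * (ENNReal.ofReal (|f x - f y| ^ p / dist x y ^ ((d : ℝ) + s * p)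
      * distBd Ω y ^ (-β) * distBd Ω x ^ (-α)) +
      ENNReal.ofReal (|g x - g y| ^ p / dist x y ^ ((d : ℝ) + s * p)
      * distBd Ω y ^ (-β) * distBd Ω x ^ (-α))) := by
  have hx := distBd_nonneg (Ω := Ω) x
  have hy := distBd_nonneg (Ω := Ω) y
  rw [← ENNReal.ofReal_add (by positivity) (by positivity),
    ← ENNReal.ofReal_mul (by positivity)]
  refine ENNReal.ofReal_le_ofReal ?_
  have h := abs_add_rpow_le (by linarith : 0 ≤ p) (f x - f y) (g x - g y)
  calc |f x + g x - (f y + g y)| ^ p / dist x y ^ ((d : ℝ) + s * p)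
        * distBd Ω y ^ (-β) * distBd Ω x ^ (-α)
      = |f x - f y + (g x - g y)| ^ p / dist x y ^ ((d : ℝ) + s * p)
        * distBd Ω y ^ (-β) * distBd Ω x ^ (-α) := by ring_nf
    _ ≤ 2 ^ p * (|f x - f y| ^ p + |g x - g y| ^ p) / dist x y ^ ((d : ℝ) + s * p)
        * distBd Ω y ^ (-β) * distBd Ω x ^ (-α) := by gcongr
    _ = _ := by ring

lemma gagP_eq_lintegral_prod {f : Rd d → ℝ} (hf : Measurable f) :
    gagP Ω s p α β f = ∫⁻ z, ENNReal.ofReal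
      (|f z.1 - f z.2| ^ p / dist z.1 z.2 ^ ((d : ℝ) + s * p)
        * distBd Ω z.2 ^ (-β) * distBd Ω z.1 ^ (-α))
      ∂(volume.restrict Ω).prod (volume.restrict Ω) :=
  (lintegral_prod _ (measurable_gagP_integrand hf).aemeasurable).symm

lemma energy_add_le (hp : 1 ≤ p) {f g : Rd d → ℝ} (hf : Measurable f) (hg : Measurable g) :
    energy Ω s p α β (fun x => f x + g x) ≤
      ENNReal.ofReal (2 ^ p) * (energy Ω s p α β f + energy Ω s p α β g) := by
  have hfm := measurable_gagP_integrand (Ω := Ω) (s := s) (p := p) (α := α) (β := β) hf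
  have h1 : ∫⁻ x in Ω, ENNReal.ofReal (|f x + g x| ^ p) ≤ ENNReal.ofReal (2 ^ p) *
      ((∫⁻ x in Ω, ENNReal.ofReal (|f x| ^ p)) + ∫⁻ x in Ω, ENNReal.ofReal (|g x| ^ p)) := by
    rw [← lintegral_add_left (by fun_prop), ← lintegral_const_mul _ (by fun_prop)]
    exact lintegral_mono fun x => ofReal_abs_add_rpow_le hp _ _
  have h2 : gagP Ω s p α β (fun x => f x + g x) ≤
      ENNReal.ofReal (2 ^ p) * (gagP Ω s p α β f + gagP Ω s p α β g) := by
    have hfg : Measurable fun x => f x + g x := hf.add hg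
    rw [gagP_eq_lintegral_prod hfg, gagP_eq_lintegral_prod hf,
      gagP_eq_lintegral_prod hg, ← lintegral_add_left hfm, ← lintegral_const_mul' _ _ ENNReal.ofReal_ne_top]
    exact lintegral_mono fun z => gagP_integrand_add_le hp z.1 z.2
  calc _ ≤ _ := add_le_add h1 h2
    _ = _ := by rw [energy, energy]; ring

lemma energy_neg (f : Rd d → ℝ) :
    energy Ω s p α β (fun x => -f x) = energy Ω s p α β f := by
  have h : ∀ x y, |-f x - -f y| = |f x - f y| := fun x y => by
    rw [← abs_neg]
    congr 1
    ring
  simp only [energy, gagP, abs_neg, h]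

/-- Smooth compactly supported functions have finite Hardy integral. -/
lemma lintegral_hardy_lt_top_of_hasCompactSupport (hopen : IsOpen Ω)
    (hbdd : Bornology.IsBounded Ω) (hfr : (frontier Ω).Nonempty) (hp : 1 ≤ p) (γ : ℝ)
    {φ : Rd d → ℝ} (hφ : Continuous φ) (hc : HasCompactSupport φ) (hsupp : tsupport φ ⊆ Ω) :
    ∫⁻ x in Ω, ENNReal.ofReal (|φ x| ^ p * distBd Ω x ^ (-γ)) < ⊤ := by
  have hp0 : 0 < p := by linarith
  have hcont : ContinuousOn (fun x => |φ x| ^ p * distBd Ω x ^ (-γ)) (tsupport φ) := by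
    refine ContinuousOn.mul (hφ.abs.rpow_const fun _ => Or.inr hp0.le).continuousOn ?_
    exact (continuous_distBd Ω).continuousOn.rpow_const fun x hx =>
      Or.inl (distBd_pos hopen hfr (hsupp hx)).ne'
  obtain ⟨M, hM⟩ := IsCompact.bddAbove_image hc hcont
  have hle : ∀ x ∈ Ω, ENNReal.ofReal (|φ x| ^ p * distBd Ω x ^ (-γ)) ≤ ENNReal.ofReal M := by
    intro x _
    by_cases hx : x ∈ tsupport φ
    · exact ENNReal.ofReal_le_ofReal (hM ⟨x, hx, rfl⟩)
    · rw [image_eq_zero_of_notMem_tsupport hx, abs_zero, Real.zero_rpow hp0.ne', zero_mul,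
        ENNReal.ofReal_zero]
      exact zero_le
  calc _ ≤ ∫⁻ _ in Ω, ENNReal.ofReal M := setLIntegral_mono measurable_const hle
    _ = ENNReal.ofReal M * volume Ω := setLIntegral_const _ _
    _ < ⊤ := ENNReal.mul_lt_top ENNReal.ofReal_lt_top hbdd.measure_lt_top

lemma lintegral_hardy_le_of_superlevel_le (hopen : IsOpen Ω) (hfr : (frontier Ω).Nonempty)
    {F : Rd d → ℝ≥0∞} {B : ℝ≥0∞}
    (h : ∀ δ : ℝ, 0 < δ → ∫⁻ x in Ω ∩ {x | δ ≤ distBd Ω x}, F x ≤ B) :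
    ∫⁻ x in Ω, F x ≤ B := by
  have hU : Ω = ⋃ n : ℕ, Ω ∩ {x | 1 / ((n : ℝ) + 1) ≤ distBd Ω x} := by
    refine subset_antisymm (fun x hx => ?_) (iUnion_subset fun n => inter_subset_left)
    obtain ⟨n, hn⟩ := exists_nat_one_div_lt (distBd_pos hopen hfr hx)
    exact mem_iUnion.2 ⟨n, hx, hn.le⟩
  have hmono : Monotone fun n : ℕ => Ω ∩ {x | 1 / ((n : ℝ) + 1) ≤ distBd Ω x} := by
    intro m n hmn x hx
    refine ⟨hx.1, show 1 / ((n : ℝ) + 1) ≤ distBd Ω x from le_trans ?_ hx.2⟩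
    have : (m : ℝ) ≤ n := by exact_mod_cast hmn
    gcongr
  rw [hU, setLIntegral_iUnion_of_directed _ hmono.directed_le]
  exact iSup_le fun n => h _ (by positivity)

lemma lintegral_hardy_lt_top_of_memW0 (hopen : IsOpen Ω) (hunif : IsUniformDomain Ω)
    (hbdd : Bornology.IsBounded Ω) (hfr : (frontier Ω).Nontrivial) (hs0 : 0 < s) (hp : 1 ≤ p)
    (hα0 : 0 ≤ α) (hβ0 : 0 ≤ β) (h : upperCodimA (frontier Ω) < s * p + α + β)
    {f : Rd d → ℝ} (hf : Measurable f) (hW : memW0 Ω s p α β f) :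
    ∫⁻ x in Ω, ENNReal.ofReal (|f x| ^ p * distBd Ω x ^ (-(s * p + α + β))) < ⊤ := by
  obtain ⟨K, hK, hardy⟩ := exists_hardy_inequality hopen hunif hfr hs0 hp hα0 hβ0 h
  have hp0 : 0 < p := by linarith
  set γ := s * p + α + β with hγ
  have hγ0 : 0 ≤ γ := by positivity
  set A := ENNReal.ofReal (2 ^ p) with hA
  have hAt : A ≠ ⊤ := ENNReal.ofReal_ne_top
  have hE : energy Ω s p α β f < ⊤ := (memW_iff_energy_lt_top hp hf).1 hW.1
  set B := A * (1 + K * (A * (energy Ω s p α β f + 2))) with hB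
  have hBt : B < ⊤ := by
    refine ENNReal.mul_lt_top hAt.lt_top (ENNReal.add_lt_top.2 ⟨by simp, ?_⟩)
    refine ENNReal.mul_lt_top hK.lt_top (ENNReal.mul_lt_top hAt.lt_top ?_)
    exact ENNReal.add_lt_top.2 ⟨hE, by simp⟩
  refine lt_of_le_of_lt (lintegral_hardy_le_of_superlevel_le hopen hfr.nonempty
    fun δ hδ => ?_) hBt
  set ε := min 1 (δ ^ γ) with hε
  have hε0 : 0 < ε := lt_min one_pos (by positivity)
  obtain ⟨φ, hφs, hφc, hφΩ, -, hφ⟩ := hW.2 ε hε0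
  have hφm : Measurable φ := hφs.continuous.measurable
  have hεp : ENNReal.ofReal ε ^ p ≤ ENNReal.ofReal ε := by
    rw [ENNReal.ofReal_rpow_of_pos hε0]
    refine ENNReal.ofReal_le_ofReal ?_
    exact Real.rpow_le_self_of_le_one hε0.le (min_le_left _ _) hp
  have hε1 : ENNReal.ofReal ε ≤ 1 := by
    rw [← ENNReal.ofReal_one]
    exact ENNReal.ofReal_le_ofReal (min_le_left _ _)
  have hL := (lintegral_abs_rpow_le_of_wNorm_lt hp hφ).trans hεp
  have hG := (gagP_le_of_wNorm_lt hp hφ).trans hεp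
  have hEφ : energy Ω s p α β φ ≤ A * (energy Ω s p α β f + 2) := by
    have h1 : energy Ω s p α β (fun x => f x - φ x) ≤ 2 := by
      calc _ ≤ (1 : ℝ≥0∞) + 1 := add_le_add (hL.trans hε1) (hG.trans hε1)
        _ = 2 := one_add_one_eq_two
    have h2 := energy_add_le (Ω := Ω) (s := s) (α := α) (β := β) hp hf (hf.sub hφm).neg
    have h3 : (fun x => f x + (-(f - φ)) x) = φ := by
      ext x
      simp
    rw [h3] at h2
    refine h2.trans ?_
    gcongr
    exact (energy_neg (fun x => f x - φ x)).trans_le h1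
  have hIφ := hardy φ hφm (lintegral_hardy_lt_top_of_hasCompactSupport hopen hbdd
    hfr.nonempty hp γ hφs.continuous hφc hφΩ).ne
  have hS : MeasurableSet (Ω ∩ {x | δ ≤ distBd Ω x}) :=
    hopen.measurableSet.inter (measurableSet_le measurable_const (measurable_distBd Ω))
  calc ∫⁻ x in Ω ∩ {x | δ ≤ distBd Ω x}, ENNReal.ofReal (|f x| ^ p * distBd Ω x ^ (-γ))
      ≤ ∫⁻ x in Ω ∩ {x | δ ≤ distBd Ω x}, A * (ENNReal.ofReal (δ ^ (-γ)) *
          ENNReal.ofReal (|f x - φ x| ^ p) +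
          ENNReal.ofReal (|φ x| ^ p * distBd Ω x ^ (-γ))) := by
        refine setLIntegral_mono' hS fun x hx => ?_
        have hx' : δ ≤ distBd Ω x := hx.2
        have hdx : 0 < distBd Ω x := hδ.trans_le hx'
        rw [hA, ← ENNReal.ofReal_mul (by positivity), ← ENNReal.ofReal_add (by positivity)
          (by positivity), ← ENNReal.ofReal_mul (by positivity)]
        refine ENNReal.ofReal_le_ofReal ?_
        have h1 := abs_add_rpow_le hp0.le (f x - φ x) (φ x)
        rw [sub_add_cancel] at h1
        have h2 : distBd Ω x ^ (-γ) ≤ δ ^ (-γ) :=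
          Real.rpow_le_rpow_of_nonpos hδ hx' (by linarith)
        calc |f x| ^ p * distBd Ω x ^ (-γ)
            ≤ 2 ^ p * (|f x - φ x| ^ p + |φ x| ^ p) * distBd Ω x ^ (-γ) := by gcongr
          _ = 2 ^ p * (distBd Ω x ^ (-γ) * |f x - φ x| ^ p +
              |φ x| ^ p * distBd Ω x ^ (-γ)) := by ring
          _ ≤ _ := by gcongr
    _ ≤ ∫⁻ x in Ω, A * (ENNReal.ofReal (δ ^ (-γ)) *
          ENNReal.ofReal (|f x - φ x| ^ p) +
          ENNReal.ofReal (|φ x| ^ p * distBd Ω x ^ (-γ))) :=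
        lintegral_mono_set inter_subset_left
    _ = A * (ENNReal.ofReal (δ ^ (-γ)) * (∫⁻ x in Ω, ENNReal.ofReal (|f x - φ x| ^ p)) +
          ∫⁻ x in Ω, ENNReal.ofReal (|φ x| ^ p * distBd Ω x ^ (-γ))) := by
        rw [lintegral_const_mul _ (by fun_prop), lintegral_add_left (by fun_prop),
          lintegral_const_mul _ (by fun_prop)]
    _ ≤ A * (1 + K * (A * (energy Ω s p α β f + 2))) := by
        gcongr
        · calc _ ≤ ENNReal.ofReal (δ ^ (-γ)) * ENNReal.ofReal (δ ^ γ) := by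
                gcongr
                exact hL.trans (ENNReal.ofReal_le_ofReal (min_le_right _ _))
            _ = 1 := by
                rw [← ENNReal.ofReal_mul (by positivity), ← Real.rpow_add hδ, neg_add_cancel,
                  Real.rpow_zero, ENNReal.ofReal_one]
        · refine hIφ.trans ?_
          gcongr
          exact hEφ

end Necessity

section Cutoff

variable {d : ℕ} {Ω : Set (Rd d)} {s p α β : ℝ}

/-- A cutoff equal to `1` within distance `1 / n` of the boundary and to `0` beyond `2 / n`. -/
noncomputable def bdCutoff (Ω : Set (Rd d)) (n : ℕ) (x : Rd d) : ℝ :=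
  max 0 (min 1 (2 - n * distBd Ω x))

lemma bdCutoff_nonneg (n : ℕ) (x : Rd d) : 0 ≤ bdCutoff Ω n x := le_max_left _ _

lemma bdCutoff_le_one (n : ℕ) (x : Rd d) : bdCutoff Ω n x ≤ 1 :=
  max_le zero_le_one (min_le_left _ _)

@[fun_prop]
lemma measurable_bdCutoff (Ω : Set (Rd d)) (n : ℕ) : Measurable (bdCutoff Ω n) := by
  unfold bdCutoff
  fun_prop

lemma bdCutoff_eq_zero {n : ℕ} {x : Rd d} (h : 2 ≤ n * distBd Ω x) : bdCutoff Ω n x = 0 :=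
  max_eq_left ((min_le_right _ _).trans (by linarith))

lemma bdCutoff_eq_one {n : ℕ} {x : Rd d} (h : n * distBd Ω x ≤ 1) : bdCutoff Ω n x = 1 := by
  rw [bdCutoff, min_eq_left (by linarith), max_eq_right zero_le_one]

lemma eventually_bdCutoff_eq_zero {x : Rd d} (hx : 0 < distBd Ω x) :
    ∀ᶠ n : ℕ in atTop, bdCutoff Ω n x = 0 := by
  have h := (tendsto_natCast_atTop_atTop (R := ℝ)).atTop_mul_const hx
  filter_upwards [h.eventually_ge_atTop 2] with n hn
  exact bdCutoff_eq_zero hn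

lemma abs_bdCutoff_sub_le {n : ℕ} {x y : Rd d} (hx : 0 < distBd Ω x) :
    |bdCutoff Ω n x - bdCutoff Ω n y| ≤ min 1 (4 * dist x y / distBd Ω x) := by
  have hx0 := bdCutoff_nonneg (Ω := Ω) n x
  have hx1 := bdCutoff_le_one (Ω := Ω) n x
  have hy0 := bdCutoff_nonneg (Ω := Ω) n y
  have hy1 := bdCutoff_le_one (Ω := Ω) n y
  have h1 : |bdCutoff Ω n x - bdCutoff Ω n y| ≤ 1 := abs_le.2 ⟨by linarith, by linarith⟩
  refine le_min h1 ?_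
  rw [le_div_iff₀ hx]
  have hxy := distBd_le_add (Ω := Ω) x y
  have hyx := distBd_le_add (Ω := Ω) y x
  rw [dist_comm y x] at hyx
  have hn : (0 : ℝ) ≤ n := n.cast_nonneg
  rcases le_total (n * distBd Ω x) 4 with h4 | h4
  · have hlip : |bdCutoff Ω n x - bdCutoff Ω n y| ≤ n * dist x y := by
      calc |bdCutoff Ω n x - bdCutoff Ω n y|
          ≤ |min 1 (2 - n * distBd Ω x) - min 1 (2 - n * distBd Ω y)| := by
            simpa [bdCutoff] using abs_max_sub_max_le_max (0 : ℝ) (min 1 (2 - n * distBd Ω x)) 0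
              (min 1 (2 - n * distBd Ω y))
        _ ≤ |(2 - n * distBd Ω x) - (2 - n * distBd Ω y)| := by
            simpa using abs_min_sub_min_le_max (1 : ℝ) (2 - n * distBd Ω x) 1
              (2 - n * distBd Ω y)
        _ ≤ n * dist x y := by
            rw [abs_le]
            constructor <;> nlinarith
    have hd := dist_nonneg (x := x) (y := y)
    nlinarith
  · rcases le_total (distBd Ω x) (4 * dist x y) with h | h
    · nlinarith
    · rw [bdCutoff_eq_zero (by linarith), bdCutoff_eq_zero (by nlinarith)]
      simp

lemma abs_mul_bdCutoff_sub_rpow_le (hp : 1 ≤ p) (f : Rd d → ℝ) {n : ℕ} {x y : Rd d}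
    (hx : 0 < distBd Ω x) :
    |f x * bdCutoff Ω n x - f y * bdCutoff Ω n y| ^ p ≤
      2 ^ p * (|f x - f y| ^ p + |f x| ^ p * min 1 (4 * dist x y / distBd Ω x) ^ p) := by
  have hp0 : 0 ≤ p := by linarith
  have h1 := abs_add_rpow_le hp0 ((f x - f y) * bdCutoff Ω n y)
    (f x * (bdCutoff Ω n x - bdCutoff Ω n y))
  rw [show (f x - f y) * bdCutoff Ω n y + f x * (bdCutoff Ω n x - bdCutoff Ω n y) =
    f x * bdCutoff Ω n x - f y * bdCutoff Ω n y by ring] at h1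
  refine h1.trans (mul_le_mul_of_nonneg_left (add_le_add ?_ ?_) (by positivity))
  · refine Real.rpow_le_rpow (abs_nonneg _) ?_ hp0
    rw [abs_mul, abs_of_nonneg (bdCutoff_nonneg n y)]
    exact mul_le_of_le_one_right (abs_nonneg _) (bdCutoff_le_one n y)
  · rw [abs_mul, Real.mul_rpow (abs_nonneg _) (abs_nonneg _)]
    gcongr
    exact abs_bdCutoff_sub_le hx

lemma tendsto_lintegral_abs_mul_bdCutoff (hopen : IsOpen Ω) (hfr : (frontier Ω).Nonempty)
    (hp : 1 ≤ p) {f : Rd d → ℝ} (hf : Measurable f)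
    (hfp : ∫⁻ x in Ω, ENNReal.ofReal (|f x| ^ p) ≠ ⊤) :
    Tendsto (fun n => ∫⁻ x in Ω, ENNReal.ofReal (|f x * bdCutoff Ω n x| ^ p)) atTop
      (nhds 0) := by
  have hp0 : 0 < p := by linarith
  have h := tendsto_lintegral_of_dominated_convergence (μ := volume.restrict Ω)
    (F := fun n x => ENNReal.ofReal (|f x * bdCutoff Ω n x| ^ p)) (f := fun _ => 0)
    (fun x => ENNReal.ofReal (|f x| ^ p)) (fun n => by fun_prop) (fun n => ?_) hfp ?_
  · simpa using h
  · refine Eventually.of_forall fun x => ENNReal.ofReal_le_ofReal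
      (Real.rpow_le_rpow (abs_nonneg _) ?_ hp0.le)
    rw [abs_mul, abs_of_nonneg (bdCutoff_nonneg n x)]
    exact mul_le_of_le_one_right (abs_nonneg _) (bdCutoff_le_one n x)
  · filter_upwards [ae_restrict_mem hopen.measurableSet] with x hx
    refine tendsto_const_nhds.congr' ?_
    filter_upwards [eventually_bdCutoff_eq_zero (distBd_pos hopen hfr hx)] with n hn
    rw [hn, mul_zero, abs_zero, Real.zero_rpow hp0.ne', ENNReal.ofReal_zero]

lemma lintegral_cutoff_majorant_lt_top (hopen : IsOpen Ω) (hbdd : Bornology.IsBounded Ω)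
    (hfr : (frontier Ω).Nontrivial) (hs0 : 0 < s) (hs1 : s < 1) (hp : 1 ≤ p) (hβ0 : 0 ≤ β)
    (hβ : β < lowerCodimA (frontier Ω)) {f : Rd d → ℝ} (hf : Measurable f)
    (hI : ∫⁻ x in Ω, ENNReal.ofReal (|f x| ^ p * distBd Ω x ^ (-(s * p + α + β))) < ⊤) :
    ∫⁻ z, ENNReal.ofReal (|f z.1| ^ p * min 1 (4 * dist z.1 z.2 / distBd Ω z.1) ^ p /
        dist z.1 z.2 ^ ((d : ℝ) + s * p) * distBd Ω z.2 ^ (-β) * distBd Ω z.1 ^ (-α))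
      ∂(volume.restrict Ω).prod (volume.restrict Ω) < ⊤ := by
  obtain ⟨C, hC, hker⟩ := exists_lintegral_kernel_le hopen hbdd hfr hs0 hs1 hp hβ0 hβ
  have h1 : Measurable fun z : Rd d × Rd d => distBd Ω z.1 :=
    (measurable_distBd Ω).comp measurable_fst
  have h2 : Measurable fun z : Rd d × Rd d => distBd Ω z.2 :=
    (measurable_distBd Ω).comp measurable_snd
  have h3 : Measurable fun z : Rd d × Rd d => |f z.1| := (hf.comp measurable_fst).abs
  rw [lintegral_prod _ (by fun_prop)]
  calc _ ≤ ∫⁻ x in Ω, ENNReal.ofReal C *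
        ENNReal.ofReal (|f x| ^ p * distBd Ω x ^ (-(s * p + α + β))) := by
        refine setLIntegral_mono (by fun_prop) fun x hx => ?_
        have hdx : 0 < distBd Ω x := distBd_pos hopen hfr.nonempty hx
        calc _ = ∫⁻ y in Ω, ENNReal.ofReal (|f x| ^ p * distBd Ω x ^ (-α)) * ENNReal.ofReal
              (min 1 (4 * dist x y / distBd Ω x) ^ p / dist x y ^ ((d : ℝ) + s * p) *
                distBd Ω y ^ (-β)) := by
              refine lintegral_congr fun y => ?_
              rw [← ENNReal.ofReal_mul (by positivity)]
              congr 1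
              ring
          _ = ENNReal.ofReal (|f x| ^ p * distBd Ω x ^ (-α)) * ∫⁻ y in Ω, ENNReal.ofReal
              (min 1 (4 * dist x y / distBd Ω x) ^ p / dist x y ^ ((d : ℝ) + s * p) *
                distBd Ω y ^ (-β)) := lintegral_const_mul' _ _ ENNReal.ofReal_ne_top
          _ ≤ ENNReal.ofReal (|f x| ^ p * distBd Ω x ^ (-α)) *
              ENNReal.ofReal (C * distBd Ω x ^ (-(s * p + β))) := by
              gcongr
              exact hker x hx
          _ = _ := by
              rw [← ENNReal.ofReal_mul (by positivity), ← ENNReal.ofReal_mul hC]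
              congr 1
              rw [show -(s * p + α + β) = -α + -(s * p + β) by ring, Real.rpow_add hdx]
              ring
    _ = ENNReal.ofReal C *
        ∫⁻ x in Ω, ENNReal.ofReal (|f x| ^ p * distBd Ω x ^ (-(s * p + α + β))) :=
        lintegral_const_mul' _ _ ENNReal.ofReal_ne_top
    _ < ⊤ := ENNReal.mul_lt_top ENNReal.ofReal_lt_top hI

lemma ae_prod_restrict_mem (hopen : IsOpen Ω) :
    ∀ᵐ z ∂(volume.restrict Ω).prod (volume.restrict Ω), z.1 ∈ Ω ∧ z.2 ∈ Ω := by
  rw [Measure.prod_restrict]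
  exact ae_restrict_mem (hopen.measurableSet.prod hopen.measurableSet)

lemma tendsto_gagP_mul_bdCutoff (hopen : IsOpen Ω) (hbdd : Bornology.IsBounded Ω)
    (hfr : (frontier Ω).Nontrivial) (hs0 : 0 < s) (hs1 : s < 1) (hp : 1 ≤ p) (hβ0 : 0 ≤ β)
    (hβ : β < lowerCodimA (frontier Ω)) {f : Rd d → ℝ} (hf : Measurable f)
    (hg : gagP Ω s p α β f < ⊤)
    (hI : ∫⁻ x in Ω, ENNReal.ofReal (|f x| ^ p * distBd Ω x ^ (-(s * p + α + β))) < ⊤) :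
    Tendsto (fun n => gagP Ω s p α β fun x => f x * bdCutoff Ω n x) atTop (nhds 0) := by
  have hp0 : 0 < p := by linarith
  have hH := lintegral_cutoff_majorant_lt_top hopen hbdd hfr hs0 hs1 hp hβ0 hβ hf hI
  have hmeas : ∀ n, Measurable fun x => f x * bdCutoff Ω n x := fun n => by fun_prop
  simp only [fun n => gagP_eq_lintegral_prod (Ω := Ω) (s := s) (p := p) (α := α) (β := β)
    (hmeas n)]
  rw [gagP_eq_lintegral_prod hf] at hg
  have hfm := measurable_gagP_integrand (Ω := Ω) (s := s) (p := p) (α := α) (β := β) hf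
  have hFm : ∀ n, Measurable fun z : Rd d × Rd d => ENNReal.ofReal
      (|f z.1 * bdCutoff Ω n z.1 - f z.2 * bdCutoff Ω n z.2| ^ p /
        dist z.1 z.2 ^ ((d : ℝ) + s * p) * distBd Ω z.2 ^ (-β) * distBd Ω z.1 ^ (-α)) := by
    intro n
    have h1 : Measurable fun z : Rd d × Rd d => distBd Ω z.1 :=
      (measurable_distBd Ω).comp measurable_fst
    have h2 : Measurable fun z : Rd d × Rd d => distBd Ω z.2 :=
      (measurable_distBd Ω).comp measurable_snd
    have h3 : Measurable fun z : Rd d × Rd d =>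
        |f z.1 * bdCutoff Ω n z.1 - f z.2 * bdCutoff Ω n z.2| :=
      (((hmeas n).comp measurable_fst).sub ((hmeas n).comp measurable_snd)).abs
    fun_prop
  have h := tendsto_lintegral_of_dominated_convergence
    (μ := (volume.restrict Ω).prod (volume.restrict Ω))
    (F := fun n z => ENNReal.ofReal
      (|f z.1 * bdCutoff Ω n z.1 - f z.2 * bdCutoff Ω n z.2| ^ p /
        dist z.1 z.2 ^ ((d : ℝ) + s * p) * distBd Ω z.2 ^ (-β) * distBd Ω z.1 ^ (-α)))
    (f := fun _ => 0)
    (fun z => ENNReal.ofReal (2 ^ p) * (ENNReal.ofReal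
      (|f z.1 - f z.2| ^ p / dist z.1 z.2 ^ ((d : ℝ) + s * p)
        * distBd Ω z.2 ^ (-β) * distBd Ω z.1 ^ (-α)) + ENNReal.ofReal
      (|f z.1| ^ p * min 1 (4 * dist z.1 z.2 / distBd Ω z.1) ^ p /
        dist z.1 z.2 ^ ((d : ℝ) + s * p) * distBd Ω z.2 ^ (-β) * distBd Ω z.1 ^ (-α))))
    hFm (fun n => ?_) ?_ ?_
  · simpa using h
  · filter_upwards [ae_prod_restrict_mem hopen] with z hz
    have hd1 := distBd_pos hopen hfr.nonempty hz.1
    have hd2 := distBd_pos hopen hfr.nonempty hz.2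
    rw [← ENNReal.ofReal_add (by positivity) (by positivity),
      ← ENNReal.ofReal_mul (by positivity)]
    refine ENNReal.ofReal_le_ofReal ?_
    have := abs_mul_bdCutoff_sub_rpow_le hp f (n := n) (x := z.1) (y := z.2) hd1
    calc _ ≤ 2 ^ p * (|f z.1 - f z.2| ^ p +
          |f z.1| ^ p * min 1 (4 * dist z.1 z.2 / distBd Ω z.1) ^ p) /
          dist z.1 z.2 ^ ((d : ℝ) + s * p) * distBd Ω z.2 ^ (-β) * distBd Ω z.1 ^ (-α) := by
          gcongr
      _ = _ := by ring
  · rw [lintegral_const_mul' _ _ ENNReal.ofReal_ne_top, lintegral_add_left hfm]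
    exact ENNReal.mul_ne_top ENNReal.ofReal_ne_top (ENNReal.add_ne_top.2 ⟨hg.ne, hH.ne⟩)
  · filter_upwards [ae_prod_restrict_mem hopen] with z hz
    refine tendsto_const_nhds.congr' ?_
    filter_upwards [eventually_bdCutoff_eq_zero (distBd_pos hopen hfr.nonempty hz.1),
      eventually_bdCutoff_eq_zero (distBd_pos hopen hfr.nonempty hz.2)] with n hn hn'
    simp [hn, hn', Real.zero_rpow hp0.ne']

lemma energy_congr (hopen : IsOpen Ω) {f g : Rd d → ℝ} (h : ∀ x ∈ Ω, f x = g x) :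
    energy Ω s p α β f = energy Ω s p α β g := by
  have hae : f =ᵐ[volume.restrict Ω] g := by
    filter_upwards [ae_restrict_mem hopen.measurableSet] with x hx using h x hx
  rw [energy, energy, gagP_congr_ae hae]
  congr 1
  refine lintegral_congr_ae ?_
  filter_upwards [hae] with x hx
  rw [hx]

lemma exists_compactly_supported_approx (hopen : IsOpen Ω) (hbdd : Bornology.IsBounded Ω)
    (hfr : (frontier Ω).Nontrivial) (hs0 : 0 < s) (hs1 : s < 1) (hp : 1 ≤ p) (hβ0 : 0 ≤ β)
    (hβ : β < lowerCodimA (frontier Ω)) {f : Rd d → ℝ} (hf : Measurable f)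
    (hE : energy Ω s p α β f < ⊤)
    (hI : ∫⁻ x in Ω, ENNReal.ofReal (|f x| ^ p * distBd Ω x ^ (-(s * p + α + β))) < ⊤)
    {ε : ℝ≥0∞} (hε : 0 < ε) :
    ∃ g : Rd d → ℝ, Measurable g ∧
      (∃ δ : ℝ, 0 < δ ∧ ∀ x, g x ≠ 0 → x ∈ Ω ∧ δ ≤ distBd Ω x) ∧
      energy Ω s p α β (fun x => f x - g x) < ε := by
  have hE' := ENNReal.add_lt_top.1 hE
  have hlim : Tendsto (fun n => energy Ω s p α β fun x => f x * bdCutoff Ω n x) atTop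
      (nhds 0) := by
    simpa [energy] using (tendsto_lintegral_abs_mul_bdCutoff hopen hfr.nonempty hp hf
      hE'.1.ne).add (tendsto_gagP_mul_bdCutoff hopen hbdd hfr hs0 hs1 hp hβ0 hβ hf hE'.2 hI)
  obtain ⟨n, hn, hn1⟩ := ((hlim.eventually_lt_const hε).and (eventually_ge_atTop 1)).exists
  have hn0 : (0 : ℝ) < n := by exact_mod_cast hn1
  refine ⟨Ω.indicator fun x => f x * (1 - bdCutoff Ω n x),
    Measurable.indicator (by fun_prop) hopen.measurableSet,
    ⟨1 / n, by positivity, fun x hx => ?_⟩, ?_⟩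
  · have hxΩ : x ∈ Ω := mem_of_indicator_ne_zero hx
    refine ⟨hxΩ, ?_⟩
    by_contra! hlt
    rw [lt_div_iff₀ hn0] at hlt
    refine hx ?_
    rw [indicator_of_mem hxΩ, bdCutoff_eq_one (by linarith), sub_self, mul_zero]
  · rw [energy_congr hopen (g := fun x => f x * bdCutoff Ω n x)]
    · exact hn
    · intro x hx
      rw [indicator_of_mem hx]
      ring

end Cutoff

section Averaging

variable {X : Type*} [NormedAddCommGroup X] [ProperSpace X] [MeasurableSpace X]
  [BorelSpace X] {μ : Measure X} [μ.IsAddHaarMeasure] {p : ℝ}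

/-- Translations act continuously on `L^p`. -/
lemma tendsto_lintegral_abs_sub_translate (hp : 1 ≤ p) {F : X → ℝ} (hF : Measurable F)
    (hFp : ∫⁻ w, ENNReal.ofReal (|F w| ^ p) ∂μ < ⊤) :
    Tendsto (fun v => ∫⁻ w, ENNReal.ofReal (|F w - F (w - v)| ^ p) ∂μ) (nhds 0) (nhds 0) := by
  have hp0 : 0 < p := by linarith
  have : Fact (1 ≤ ENNReal.ofReal p) := ⟨by simpa using ENNReal.ofReal_le_ofReal hp⟩
  have hmem : MemLp F (ENNReal.ofReal p) μ := by
    refine ⟨hF.aestronglyMeasurable, ?_⟩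
    rw [eLpNorm_eq_lintegral_abs_rpow hp]
    exact ENNReal.rpow_lt_top_of_nonneg (by positivity) hFp.ne
  let T : X → C(X, X) := fun v => ⟨fun w => w - v, by fun_prop⟩
  have hTc : Continuous T :=
    ContinuousMap.continuous_of_continuous_uncurry T (by
      change Continuous fun z : X × X => z.2 - z.1
      fun_prop)
  have hTm : ∀ v, MeasurePreserving (T v) μ μ := fun v => measurePreserving_sub_right μ v
  have hcont : Continuous fun v => Lp.compMeasurePreserving (T v) (hTm v) (hmem.toLp F) :=
    continuous_const.compMeasurePreservingLp hTc hTm ENNReal.ofReal_ne_top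
  have hlim := (tendsto_const_nhds (x := hmem.toLp F)).edist (hcont.tendsto 0)
  have h0 : Lp.compMeasurePreserving (T 0) (hTm 0) (hmem.toLp F) = hmem.toLp F := by
    rw [Lp.toLp_compMeasurePreserving]
    congr 1
    ext w
    simp [T]
  rw [h0, edist_self] at hlim
  have hlim' := hlim.ennrpow_const p
  rw [ENNReal.zero_rpow_of_pos hp0] at hlim'
  refine hlim'.congr fun v => ?_
  rw [Lp.toLp_compMeasurePreserving, Lp.edist_toLp_toLp, eLpNorm_eq_lintegral_abs_rpow hp,
    ← ENNReal.rpow_mul, one_div, inv_mul_cancel₀ hp0.ne', ENNReal.rpow_one]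
  rfl

lemma ofReal_abs_integral_rpow_le {Y : Type*} [MeasurableSpace Y] {ν : Measure Y}
    [IsProbabilityMeasure ν] (hp : 1 ≤ p) {u : Y → ℝ} (hu : AEStronglyMeasurable u ν) :
    ENNReal.ofReal (|∫ t, u t ∂ν| ^ p) ≤ ∫⁻ t, ENNReal.ofReal (|u t| ^ p) ∂ν := by
  have hp0 : 0 < p := by linarith
  have h1 : ‖∫ t, u t ∂ν‖ₑ ≤ eLpNorm u (ENNReal.ofReal p) ν := by
    refine (enorm_integral_le_lintegral_enorm u).trans ?_
    rw [← eLpNorm_one_eq_lintegral_enorm]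
    exact eLpNorm_le_eLpNorm_of_exponent_le (by simpa using ENNReal.ofReal_le_ofReal hp) hu
  rw [eLpNorm_eq_lintegral_abs_rpow hp] at h1
  have h2 := ENNReal.rpow_le_rpow h1 hp0.le
  rw [← ENNReal.rpow_mul, one_div, inv_mul_cancel₀ hp0.ne', ENNReal.rpow_one] at h2
  rwa [← ENNReal.ofReal_rpow_of_nonneg (abs_nonneg _) hp0.le, ← Real.enorm_eq_ofReal_abs]

/-- If the translates of `F` by `T t` are `ε`-close to `F` in `L^p` for almost every `t`, then so
is their average. -/
lemma lintegral_abs_sub_average_le [SecondCountableTopology X] {Y : Type*} [MeasurableSpace Y]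
    {ν : Measure Y}
    [IsProbabilityMeasure ν] (hp : 1 ≤ p) {F : X → ℝ} (hF : Measurable F) {T : Y → X}
    (hT : Measurable T) (hgint : ∀ w, Integrable (fun t => F (w - T t)) ν) {ε : ℝ≥0∞}
    (hε : ∀ᵐ t ∂ν, ∫⁻ w, ENNReal.ofReal (|F w - F (w - T t)| ^ p) ∂μ ≤ ε) :
    ∫⁻ w, ENNReal.ofReal (|F w - ∫ t, F (w - T t) ∂ν| ^ p) ∂μ ≤ ε := by
  have hmeas : Measurable fun z : X × Y => ENNReal.ofReal (|F z.1 - F (z.1 - T z.2)| ^ p) := by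
    fun_prop
  calc ∫⁻ w, ENNReal.ofReal (|F w - ∫ t, F (w - T t) ∂ν| ^ p) ∂μ
      ≤ ∫⁻ w, ∫⁻ t, ENNReal.ofReal (|F w - F (w - T t)| ^ p) ∂ν ∂μ := by
        refine lintegral_mono fun w => ?_
        have h : F w - ∫ t, F (w - T t) ∂ν = ∫ t, (F w - F (w - T t)) ∂ν := by
          rw [integral_sub (integrable_const _) (hgint w)]
          simp
        rw [h]
        exact ofReal_abs_integral_rpow_le hp
          ((integrable_const _).sub (hgint w)).aestronglyMeasurable
    _ = ∫⁻ t, ∫⁻ w, ENNReal.ofReal (|F w - F (w - T t)| ^ p) ∂μ ∂ν :=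
        lintegral_lintegral_swap hmeas.aemeasurable
    _ ≤ ∫⁻ _, ε ∂ν := lintegral_mono_ae hε
    _ = ε := by simp

end Averaging

section NearQuotient

variable {d : ℕ} {Ω : Set (Rd d)} {s p α β : ℝ}

/-- The difference quotient whose `L^p`-norm is the Gagliardo seminorm, restricted to pairs of
points at distance less than `ρ`. -/
noncomputable def nearQuotient (ρ s p : ℝ) (g : Rd d → ℝ) (z : Rd d × Rd d) : ℝ :=
  (if dist z.1 z.2 < ρ then dist z.1 z.2 ^ (-(((d : ℝ) + s * p) / p)) else 0) * (g z.1 - g z.2)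

lemma measurable_nearQuotient {ρ : ℝ} {g : Rd d → ℝ} (hg : Measurable g) :
    Measurable (nearQuotient ρ s p g) := by
  unfold nearQuotient
  have hd : Measurable fun z : Rd d × Rd d => dist z.1 z.2 := by fun_prop
  have h1 : Measurable fun z : Rd d × Rd d => g z.1 - g z.2 := by fun_prop
  exact (Measurable.ite (measurableSet_lt hd measurable_const) (hd.pow_const _)
    measurable_const).mul h1

lemma abs_nearQuotient_rpow (hp : 1 ≤ p) {ρ : ℝ} (g : Rd d → ℝ) {x y : Rd d}
    (hxy : dist x y < ρ) :
    |nearQuotient ρ s p g (x, y)| ^ p = |g x - g y| ^ p / dist x y ^ ((d : ℝ) + s * p) := by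
  have hp0 : p ≠ 0 := by linarith
  have hd := dist_nonneg (x := x) (y := y)
  rw [nearQuotient]
  simp only [if_pos hxy]
  rw [abs_mul, Real.mul_rpow (abs_nonneg _) (abs_nonneg _), abs_of_nonneg (by positivity),
    ← Real.rpow_mul hd, neg_mul, div_mul_cancel₀ _ hp0, Real.rpow_neg hd]
  field_simp

lemma nearQuotient_eq_zero {ρ : ℝ} (g : Rd d → ℝ) {x y : Rd d} (hxy : ρ ≤ dist x y) :
    nearQuotient ρ s p g (x, y) = 0 := by
  simp [nearQuotient, hxy.not_gt]

lemma lintegral_nearQuotient_lt_top (hopen : IsOpen Ω) (hbdd : Bornology.IsBounded Ω)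
    (hfr : (frontier Ω).Nonempty) (hp : 1 ≤ p) (hα0 : 0 ≤ α) (hβ0 : 0 ≤ β) {g : Rd d → ℝ}
    (hg : Measurable g) {ρ : ℝ} (hsupp : ∀ x, g x ≠ 0 → x ∈ Ω ∧ ρ ≤ distBd Ω x)
    (hE : energy Ω s p α β g < ⊤) :
    ∫⁻ z, ENNReal.ofReal (|nearQuotient ρ s p g z| ^ p) < ⊤ := by
  have hp0 : p ≠ 0 := by linarith
  obtain ⟨D, hD, hDle⟩ := exists_distBd_le hbdd hfr
  have hgag : gagP Ω s p α β g < ⊤ := lt_of_le_of_lt (by simp [energy]) hE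
  have hmem : ∀ x y, g x ≠ 0 → dist y x < ρ → x ∈ Ω ∧ y ∈ Ω := fun x y hx hy =>
    ⟨(hsupp x hx).1, ball_distBd_subset hopen (hsupp x hx).1
      (mem_ball.2 (hy.trans_le (hsupp x hx).2))⟩
  have hw : ∀ a : ℝ, 0 ≤ a → ∀ x ∈ Ω, 1 ≤ D ^ a * distBd Ω x ^ (-a) := fun a ha x hx => by
    have h1 := Real.rpow_le_rpow_of_nonpos (distBd_pos hopen hfr hx) (hDle x hx)
      (neg_nonpos.2 ha)
    calc (1 : ℝ) = D ^ a * D ^ (-a) := by rw [← Real.rpow_add hD, add_neg_cancel, Real.rpow_zero]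
      _ ≤ _ := by gcongr
  have hpt : ∀ z : Rd d × Rd d, ENNReal.ofReal (|nearQuotient ρ s p g z| ^ p) ≤
      (Ω ×ˢ Ω).indicator (fun z => ENNReal.ofReal (D ^ β * D ^ α) * ENNReal.ofReal
        (|g z.1 - g z.2| ^ p / dist z.1 z.2 ^ ((d : ℝ) + s * p)
          * distBd Ω z.2 ^ (-β) * distBd Ω z.1 ^ (-α))) z := by
    rintro ⟨x, y⟩
    rcases le_or_gt ρ (dist x y) with hxy | hxy
    · simp [nearQuotient_eq_zero g hxy, Real.zero_rpow hp0]
    rw [abs_nearQuotient_rpow hp g hxy]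
    by_cases heq : g x = g y
    · simp [heq, Real.zero_rpow hp0]
    have hΩ : x ∈ Ω ∧ y ∈ Ω := by
      by_cases hx : g x = 0
      · exact (hmem y x (fun hy => heq (hx.trans hy.symm)) hxy).symm
      · exact hmem x y hx (by rwa [dist_comm])
    rw [indicator_of_mem (show (x, y) ∈ Ω ×ˢ Ω from hΩ), ← ENNReal.ofReal_mul (by positivity)]
    refine ENNReal.ofReal_le_ofReal ?_
    have h1 := hw α hα0 x hΩ.1
    have h2 := hw β hβ0 y hΩ.2
    have h3 : 1 ≤ (D ^ β * distBd Ω y ^ (-β)) * (D ^ α * distBd Ω x ^ (-α)) :=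
      one_le_mul_of_one_le_of_one_le h2 h1
    have h4 : 0 ≤ |g x - g y| ^ p / dist x y ^ ((d : ℝ) + s * p) := by positivity
    calc _ ≤ |g x - g y| ^ p / dist x y ^ ((d : ℝ) + s * p) *
          ((D ^ β * distBd Ω y ^ (-β)) * (D ^ α * distBd Ω x ^ (-α))) :=
          le_mul_of_one_le_right h4 h3
      _ = _ := by ring
  refine (lintegral_mono hpt).trans_lt ?_
  rw [lintegral_indicator (hopen.measurableSet.prod hopen.measurableSet),
    lintegral_const_mul' _ _ ENNReal.ofReal_ne_top, Measure.volume_eq_prod,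
    ← Measure.prod_restrict, ← gagP_eq_lintegral_prod hg]
  exact ENNReal.mul_lt_top ENNReal.ofReal_lt_top hgag

lemma gagP_integrand_le_near_add_far (hp : 1 ≤ p) (hs0 : 0 < s) (hα0 : 0 ≤ α) (hβ0 : 0 ≤ β)
    {ρ : ℝ} (hρ : 0 < ρ) {h : Rd d → ℝ} (hsupp : ∀ x, h x ≠ 0 → 2 * ρ ≤ distBd Ω x)
    (x y : Rd d) :
    |h x - h y| ^ p / dist x y ^ ((d : ℝ) + s * p) * distBd Ω y ^ (-β) * distBd Ω x ^ (-α) ≤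
      ρ ^ (-β) * ρ ^ (-α) * |nearQuotient ρ s p h (x, y)| ^ p +
      2 ^ p / ρ ^ ((d : ℝ) + s * p) * (ρ ^ (-α) * (|h x| ^ p * distBd Ω y ^ (-β)) +
        ρ ^ (-β) * (|h y| ^ p * distBd Ω x ^ (-α))) := by
  have hp0 : p ≠ 0 := by linarith
  have hdx := distBd_nonneg (Ω := Ω) x
  have hdy := distBd_nonneg (Ω := Ω) y
  have hw : ∀ a : ℝ, 0 ≤ a → ∀ u, ρ ≤ distBd Ω u → distBd Ω u ^ (-a) ≤ ρ ^ (-a) := fun a ha u hu =>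
    Real.rpow_le_rpow_of_nonpos hρ hu (neg_nonpos.2 ha)
  rcases le_or_gt ρ (dist x y) with hxy | hxy
  · have hv : ∀ a : ℝ, 0 ≤ a → ∀ u, |h u| ^ p * distBd Ω u ^ (-a) ≤ ρ ^ (-a) * |h u| ^ p := by
      intro a ha u
      by_cases hu : h u = 0
      · simp [hu, Real.zero_rpow hp0]
      · rw [mul_comm]
        have := hw a ha u (by linarith [hsupp u hu])
        gcongr
    have h1 : |h x - h y| ^ p ≤ 2 ^ p * (|h x| ^ p + |h y| ^ p) := by
      simpa [sub_eq_add_neg] using abs_add_rpow_le (p := p) (by linarith) (h x) (-h y)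
    have h2 : ρ ^ ((d : ℝ) + s * p) ≤ dist x y ^ ((d : ℝ) + s * p) :=
      Real.rpow_le_rpow hρ.le hxy (by positivity)
    rw [nearQuotient_eq_zero h hxy]
    calc _ ≤ 2 ^ p * (|h x| ^ p + |h y| ^ p) / ρ ^ ((d : ℝ) + s * p) * distBd Ω y ^ (-β) *
          distBd Ω x ^ (-α) := by
          have : |h x - h y| ^ p / dist x y ^ ((d : ℝ) + s * p) ≤
              2 ^ p * (|h x| ^ p + |h y| ^ p) / ρ ^ ((d : ℝ) + s * p) :=
            div_le_div₀ (by positivity) h1 (by positivity) h2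
          gcongr
      _ = 2 ^ p / ρ ^ ((d : ℝ) + s * p) * ((|h x| ^ p * distBd Ω x ^ (-α)) * distBd Ω y ^ (-β) +
          (|h y| ^ p * distBd Ω y ^ (-β)) * distBd Ω x ^ (-α)) := by ring
      _ ≤ 2 ^ p / ρ ^ ((d : ℝ) + s * p) * ((ρ ^ (-α) * |h x| ^ p) * distBd Ω y ^ (-β) +
          (ρ ^ (-β) * |h y| ^ p) * distBd Ω x ^ (-α)) := by
          have e1 := hv α hα0 x
          have e2 := hv β hβ0 y
          refine mul_le_mul_of_nonneg_left (add_le_add ?_ ?_) (by positivity)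
          · exact mul_le_mul_of_nonneg_right e1 (by positivity)
          · exact mul_le_mul_of_nonneg_right e2 (by positivity)
      _ = _ := by
          rw [abs_zero, Real.zero_rpow hp0]
          ring
  · have hnear : |h x - h y| ^ p / dist x y ^ ((d : ℝ) + s * p) * distBd Ω y ^ (-β) *
        distBd Ω x ^ (-α) ≤ ρ ^ (-β) * ρ ^ (-α) * |nearQuotient ρ s p h (x, y)| ^ p := by
      rw [abs_nearQuotient_rpow hp h hxy]
      by_cases heq : h x = h y
      · simp [heq, Real.zero_rpow hp0]
      have hxy1 := distBd_le_add (Ω := Ω) x y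
      have hxy2 := distBd_le_add (Ω := Ω) y x
      rw [dist_comm y x] at hxy2
      have hd : ρ ≤ distBd Ω x ∧ ρ ≤ distBd Ω y := by
        by_cases hx : h x = 0
        · have := hsupp y fun hy => heq (hx.trans hy.symm)
          constructor <;> linarith
        · have := hsupp x hx
          constructor <;> linarith
      have e1 := hw α hα0 x hd.1
      have e2 := hw β hβ0 y hd.2
      calc _ ≤ |h x - h y| ^ p / dist x y ^ ((d : ℝ) + s * p) * ρ ^ (-β) * ρ ^ (-α) := by
            refine mul_le_mul (mul_le_mul_of_nonneg_left e2 (by positivity)) e1 (by positivity)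
              (by positivity)
        _ = _ := by ring
    refine hnear.trans (le_add_of_nonneg_right ?_)
    positivity

/-- For functions supported away from the boundary, the weighted energy is controlled by the
`L^p`-norm and the unweighted seminorm over nearby points. -/
lemma exists_energy_le_nearQuotient (hs0 : 0 < s) (hp : 1 ≤ p)
    (hα0 : 0 ≤ α) (hβ0 : 0 ≤ β)
    (hIα : ∫⁻ x in Ω, ENNReal.ofReal (distBd Ω x ^ (-α)) < ⊤)
    (hIβ : ∫⁻ x in Ω, ENNReal.ofReal (distBd Ω x ^ (-β)) < ⊤) {ρ : ℝ} (hρ : 0 < ρ) :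
    ∃ K : ℝ≥0∞, K ≠ ⊤ ∧ ∀ h : Rd d → ℝ, Measurable h → (∀ x, h x ≠ 0 → 2 * ρ ≤ distBd Ω x) →
      energy Ω s p α β h ≤ K * ((∫⁻ x, ENNReal.ofReal (|h x| ^ p)) +
        ∫⁻ z, ENNReal.ofReal (|nearQuotient ρ s p h z| ^ p)) := by
  set Iα := ∫⁻ x in Ω, ENNReal.ofReal (distBd Ω x ^ (-α)) with hIαdef
  set Iβ := ∫⁻ x in Ω, ENNReal.ofReal (distBd Ω x ^ (-β)) with hIβdef
  set A := ENNReal.ofReal (ρ ^ (-β) * ρ ^ (-α)) with hA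
  set B := ENNReal.ofReal (2 ^ p / ρ ^ ((d : ℝ) + s * p)) with hB
  set Eα := ENNReal.ofReal (ρ ^ (-α)) with hEα
  set Eβ := ENNReal.ofReal (ρ ^ (-β)) with hEβ
  refine ⟨1 + A + B * (Eα * Iβ + Eβ * Iα), ?_, fun h hh hsupp => ?_⟩
  · refine ENNReal.add_ne_top.2 ⟨ENNReal.add_ne_top.2 ⟨ENNReal.one_ne_top,
      ENNReal.ofReal_ne_top⟩, ENNReal.mul_ne_top ENNReal.ofReal_ne_top (ENNReal.add_ne_top.2
      ⟨ENNReal.mul_ne_top ENNReal.ofReal_ne_top hIβ.ne,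
        ENNReal.mul_ne_top ENNReal.ofReal_ne_top hIα.ne⟩)⟩
  set M := ∫⁻ x, ENNReal.ofReal (|h x| ^ p) with hM
  set N := ∫⁻ z, ENNReal.ofReal (|nearQuotient ρ s p h z| ^ p) with hN
  have hnm := measurable_nearQuotient (ρ := ρ) (s := s) (p := p) hh
  have hm1 : Measurable fun x => ENNReal.ofReal (|h x| ^ p) := by fun_prop
  have hm2 : ∀ a : ℝ, Measurable fun x => ENNReal.ofReal (distBd Ω x ^ (-a)) := by
    intro a
    fun_prop
  have hMΩ : ∫⁻ x in Ω, ENNReal.ofReal (|h x| ^ p) ≤ M := setLIntegral_le_lintegral _ _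
  have hgag : gagP Ω s p α β h ≤ A * N + B * (Eα * (M * Iβ) + Eβ * (Iα * M)) := by
    rw [gagP_eq_lintegral_prod hh]
    calc _ ≤ ∫⁻ z, (A * ENNReal.ofReal (|nearQuotient ρ s p h z| ^ p) +
          B * (Eα * (ENNReal.ofReal (|h z.1| ^ p) * ENNReal.ofReal (distBd Ω z.2 ^ (-β))) +
            Eβ * (ENNReal.ofReal (distBd Ω z.1 ^ (-α)) * ENNReal.ofReal (|h z.2| ^ p))))
            ∂(volume.restrict Ω).prod (volume.restrict Ω) := by
          refine lintegral_mono fun z => ?_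
          obtain ⟨x, y⟩ := z
          refine (ENNReal.ofReal_le_ofReal
            (gagP_integrand_le_near_add_far hp hs0 hα0 hβ0 hρ hsupp x y)).trans_eq ?_
          have hdx := distBd_nonneg (Ω := Ω) x
          have hdy := distBd_nonneg (Ω := Ω) y
          rw [ENNReal.ofReal_add (by positivity) (by positivity),
            ENNReal.ofReal_mul (p := ρ ^ (-β) * ρ ^ (-α)) (by positivity),
            ENNReal.ofReal_mul (p := 2 ^ p / ρ ^ ((d : ℝ) + s * p)) (by positivity),
            ENNReal.ofReal_add (by positivity) (by positivity),
            ENNReal.ofReal_mul (p := ρ ^ (-α)) (by positivity),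
            ENNReal.ofReal_mul (p := ρ ^ (-β)) (q := |h y| ^ p * distBd Ω x ^ (-α)) (by positivity),
            ENNReal.ofReal_mul (p := |h x| ^ p) (by positivity),
            ENNReal.ofReal_mul (p := |h y| ^ p) (by positivity),
            mul_comm (ENNReal.ofReal (|h y| ^ p))]
      _ ≤ _ := by
          have k1 : Measurable fun z : Rd d × Rd d =>
              ENNReal.ofReal (|nearQuotient ρ s p h z| ^ p) := by fun_prop
          have k2 : Measurable fun z : Rd d × Rd d =>
              ENNReal.ofReal (|h z.1| ^ p) * ENNReal.ofReal (distBd Ω z.2 ^ (-β)) :=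
            (hm1.comp measurable_fst).mul ((hm2 β).comp measurable_snd)
          have k3 : Measurable fun z : Rd d × Rd d =>
              ENNReal.ofReal (distBd Ω z.1 ^ (-α)) * ENNReal.ofReal (|h z.2| ^ p) :=
            ((hm2 α).comp measurable_fst).mul (hm1.comp measurable_snd)
          rw [lintegral_add_left (k1.const_mul _), lintegral_const_mul _ k1,
            lintegral_const_mul' _ _ ENNReal.ofReal_ne_top,
            lintegral_add_left (k2.const_mul _), lintegral_const_mul _ k2,
            lintegral_const_mul _ k3,
            lintegral_prod_mul hm1.aemeasurable (hm2 β).aemeasurable,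
            lintegral_prod_mul (hm2 α).aemeasurable hm1.aemeasurable, Measure.prod_restrict]
          gcongr
          exact setLIntegral_le_lintegral _ _
  calc energy Ω s p α β h ≤ M + (A * N + B * (Eα * (M * Iβ) + Eβ * (Iα * M))) :=
        add_le_add hMΩ hgag
    _ = 1 * M + A * N + B * (Eα * Iβ + Eβ * Iα) * M := by ring
    _ ≤ 1 * (M + N) + A * (M + N) + B * (Eα * Iβ + Eβ * Iα) * (M + N) := by
        gcongr
        · exact le_self_add
        · exact le_add_self
        · exact le_self_add
    _ = _ := by ring

end NearQuotient

section Mollification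

variable {d : ℕ} {Ω : Set (Rd d)} {s p α β : ℝ}

lemma nearQuotient_sub_diag (ρ : ℝ) (g : Rd d → ℝ) (z : Rd d × Rd d) (t : Rd d) :
    nearQuotient ρ s p g (z - (t, t)) =
      (if dist z.1 z.2 < ρ then dist z.1 z.2 ^ (-(((d : ℝ) + s * p) / p)) else 0) *
        (g (z.1 - t) - g (z.2 - t)) := by
  simp [nearQuotient]

/-- The probability measure on `ℝ^d` whose density is a normalised smooth bump. -/
noncomputable def bumpMeasure (η : ContDiffBump (0 : Rd d)) : Measure (Rd d) :=
  volume.withDensity fun t => ENNReal.ofReal (η.normed volume t)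

lemma measurable_ofReal_normed (η : ContDiffBump (0 : Rd d)) :
    Measurable fun t => ENNReal.ofReal (η.normed volume t) :=
  η.continuous_normed.measurable.ennreal_ofReal

instance isProbabilityMeasure_bumpMeasure (η : ContDiffBump (0 : Rd d)) :
    IsProbabilityMeasure (bumpMeasure η) := by
  refine ⟨?_⟩
  rw [bumpMeasure, withDensity_apply _ MeasurableSet.univ, Measure.restrict_univ,
    ← ofReal_integral_eq_lintegral_ofReal η.integrable_normed
      (Eventually.of_forall η.nonneg_normed), η.integral_normed, ENNReal.ofReal_one]

lemma ae_bumpMeasure_mem_ball (η : ContDiffBump (0 : Rd d)) :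
    ∀ᵐ t ∂bumpMeasure η, t ∈ ball (0 : Rd d) η.rOut := by
  rw [bumpMeasure, ae_withDensity_iff (measurable_ofReal_normed η)]
  refine Eventually.of_forall fun t ht => ?_
  rw [← η.support_normed_eq (μ := volume)]
  intro h0
  exact ht (by simp [h0])

lemma integrable_bumpMeasure (η : ContDiffBump (0 : Rd d)) {g : Rd d → ℝ} (hg : Integrable g)
    (x : Rd d) : Integrable (fun t => g (x - t)) (bumpMeasure η) := by
  rw [bumpMeasure, integrable_withDensity_iff_integrable_smul' (measurable_ofReal_normed η)
    (Eventually.of_forall fun _ => ENNReal.ofReal_lt_top)]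
  obtain ⟨C, hC⟩ := η.hasCompactSupport_normed.exists_bound_of_continuous
    (η.continuous_normed (μ := volume))
  refine ((hg.comp_sub_left x).bdd_mul
    (η.continuous_normed (μ := volume)).aestronglyMeasurable
    (Eventually.of_forall hC)).congr (Eventually.of_forall fun t => ?_)
  simp [ENNReal.toReal_ofReal (η.nonneg_normed t)]

lemma contDiff_integral_bumpMeasure (η : ContDiffBump (0 : Rd d)) {g : Rd d → ℝ}
    (hg : Integrable g) :
    ContDiff ℝ (⊤ : ℕ∞) fun x => ∫ t, g (x - t) ∂bumpMeasure η := by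
  have h := η.hasCompactSupport_normed.contDiff_convolution_left (μ := volume)
    (ContinuousLinearMap.lsmul ℝ ℝ) (η.contDiff_normed (n := (⊤ : ℕ∞)) (μ := volume))
    hg.locallyIntegrable
  convert h using 1
  ext x
  rw [convolution_def, bumpMeasure, integral_withDensity_eq_integral_toReal_smul
    (measurable_ofReal_normed η) (Eventually.of_forall fun _ => ENNReal.ofReal_lt_top)]
  simp [ENNReal.toReal_ofReal (η.nonneg_normed _)]

lemma mem_and_le_distBd_of_integral_bumpMeasure_ne_zero (hopen : IsOpen Ω) {δ : ℝ}
    {g : Rd d → ℝ} (hsupp : ∀ x, g x ≠ 0 → x ∈ Ω ∧ δ ≤ distBd Ω x) (hδ : 0 < δ)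
    (η : ContDiffBump (0 : Rd d)) (hη : η.rOut ≤ δ / 2) {x : Rd d}
    (hx : ∫ t, g (x - t) ∂bumpMeasure η ≠ 0) : x ∈ Ω ∧ δ / 2 ≤ distBd Ω x := by
  obtain ⟨t, ht, hgt⟩ : ∃ t ∈ ball (0 : Rd d) η.rOut, g (x - t) ≠ 0 := by
    by_contra! hcon
    refine hx (integral_eq_zero_of_ae ?_)
    filter_upwards [ae_bumpMeasure_mem_ball η] with t ht
    exact hcon t ht
  obtain ⟨hΩ, hd⟩ := hsupp _ hgt
  have hdist : dist x (x - t) < δ / 2 := by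
    rw [dist_eq_norm, sub_sub_cancel]
    exact (mem_ball_zero_iff.1 ht).trans_le hη
  refine ⟨ball_distBd_subset hopen hΩ (mem_ball.2 (by linarith)), ?_⟩
  have := distBd_le_add (Ω := Ω) (x - t) x
  rw [dist_comm] at this
  linarith

lemma hasCompactSupport_and_tsupport_subset (hopen : IsOpen Ω) (hbdd : Bornology.IsBounded Ω)
    {c : ℝ} (hc : 0 < c) {φ : Rd d → ℝ} (hφ : ∀ x, φ x ≠ 0 → x ∈ Ω ∧ c ≤ distBd Ω x) :
    HasCompactSupport φ ∧ tsupport φ ⊆ Ω := by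
  have hcl : IsClosed (closure Ω ∩ {x | c ≤ distBd Ω x}) :=
    isClosed_closure.inter (isClosed_le continuous_const (continuous_distBd Ω))
  have hsub : tsupport φ ⊆ closure Ω ∩ {x | c ≤ distBd Ω x} :=
    closure_minimal (fun x hx => ⟨subset_closure (hφ x hx).1, (hφ x hx).2⟩) hcl
  constructor
  · exact Metric.isCompact_of_isClosed_isBounded (isClosed_tsupport φ)
      (hbdd.closure.subset fun x hx => (hsub hx).1)
  · intro x hx
    obtain ⟨hx1, hx2⟩ := hsub hx
    by_contra hxΩ
    have hfr : x ∈ frontier Ω := by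
      rw [hopen.frontier_eq]
      exact ⟨hx1, hxΩ⟩
    have h0 : distBd Ω x = 0 := Metric.infDist_zero_of_mem hfr
    have hx2' : c ≤ distBd Ω x := hx2
    linarith

lemma integrable_of_energy_lt_top (hbdd : Bornology.IsBounded Ω) (hp : 1 ≤ p)
    {g : Rd d → ℝ} (hg : Measurable g) (hsupp : ∀ x, g x ≠ 0 → x ∈ Ω)
    (hE : energy Ω s p α β g < ⊤) : Integrable g := by
  have : IsFiniteMeasure (volume.restrict Ω) := ⟨by simpa using hbdd.measure_lt_top⟩
  have hmem := ((memW_iff_energy_lt_top hp hg).2 hE).1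
  have hi : IntegrableOn g Ω := hmem.integrable (by simpa using ENNReal.ofReal_le_ofReal hp)
  exact (integrableOn_iff_integrable_of_support_subset hsupp).1 hi

/-- Functions of finite energy supported away from the boundary can be approximated by smooth
compactly supported functions. -/
lemma exists_smooth_approx (hopen : IsOpen Ω) (hbdd : Bornology.IsBounded Ω)
    (hfr : (frontier Ω).Nontrivial) (hs0 : 0 < s) (hp : 1 ≤ p)
    (hα0 : 0 ≤ α) (hα : α < lowerCodimA (frontier Ω))
    (hβ0 : 0 ≤ β) (hβ : β < lowerCodimA (frontier Ω)) {g : Rd d → ℝ} (hg : Measurable g)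
    {δ : ℝ} (hδ : 0 < δ) (hsupp : ∀ x, g x ≠ 0 → x ∈ Ω ∧ δ ≤ distBd Ω x)
    (hE : energy Ω s p α β g < ⊤) {ε : ℝ≥0∞} (hε : 0 < ε) :
    ∃ φ : Rd d → ℝ, ContDiff ℝ (⊤ : ℕ∞) φ ∧ HasCompactSupport φ ∧ tsupport φ ⊆ Ω ∧
      energy Ω s p α β (fun x => g x - φ x) < ε := by
  have hp0 : p ≠ 0 := by linarith
  have hρ : 0 < δ / 4 := by linarith
  obtain ⟨K, hK, hKle⟩ := exists_energy_le_nearQuotient hs0 hp hα0 hβ0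
    (lintegral_distBd_rpow_lt_top hopen hbdd hfr hα0 hα)
    (lintegral_distBd_rpow_lt_top hopen hbdd hfr hβ0 hβ) hρ
  obtain ⟨n, hn, hnlt⟩ := ENNReal.exists_nnreal_pos_mul_lt
    (ENNReal.mul_ne_top ENNReal.ofNat_ne_top hK : 2 * K ≠ ⊤) hε.ne'
  have hgi : Integrable g :=
    integrable_of_energy_lt_top hbdd hp hg (fun x hx => (hsupp x hx).1) hE
  have hgp : ∫⁻ x, ENNReal.ofReal (|g x| ^ p) < ⊤ := by
    have h1 : ∫⁻ x, ENNReal.ofReal (|g x| ^ p) = ∫⁻ x in Ω, ENNReal.ofReal (|g x| ^ p) := by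
      rw [← lintegral_indicator hopen.measurableSet]
      refine lintegral_congr fun x => ?_
      by_cases hx : x ∈ Ω
      · simp [hx]
      · have : g x = 0 := by
          by_contra h0
          exact hx (hsupp x h0).1
        simp [hx, this, Real.zero_rpow hp0]
    rw [h1]
    exact lt_of_le_of_lt (by simp [energy]) hE
  have hG := measurable_nearQuotient (ρ := δ / 4) (s := s) (p := p) hg
  have hGp : ∫⁻ z, ENNReal.ofReal (|nearQuotient (δ / 4) s p g z| ^ p) < ⊤ :=
    lintegral_nearQuotient_lt_top hopen hbdd hfr.nonempty hp hα0 hβ0 hg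
      (fun x hx => ⟨(hsupp x hx).1, by linarith [(hsupp x hx).2]⟩) hE
  have hn' : (0 : ℝ≥0∞) < n := by exact_mod_cast hn
  have hdiag : Tendsto (fun t : Rd d => (t, t)) (nhds 0) (nhds 0) :=
    (continuous_id.prodMk continuous_id).tendsto' 0 0 rfl
  have hhaar : (volume : Measure (Rd d × Rd d)).IsAddHaarMeasure := by
    rw [Measure.volume_eq_prod]
    infer_instance
  have hev1 := (tendsto_lintegral_abs_sub_translate (μ := volume) hp hg hgp).eventually_lt_const
    hn'
  have hev2 := ((tendsto_lintegral_abs_sub_translate (μ := volume) hp hG hGp).comp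
    hdiag).eventually_lt_const hn'
  obtain ⟨r, hr, hball⟩ := Metric.eventually_nhds_iff_ball.1 (hev1.and hev2)
  have hr' : 0 < min r (δ / 2) := lt_min hr (by linarith)
  let η : ContDiffBump (0 : Rd d) := ⟨min r (δ / 2) / 2, min r (δ / 2), by linarith, by linarith⟩
  have hηr : ∀ᵐ t ∂bumpMeasure η, t ∈ ball (0 : Rd d) r :=
    (ae_bumpMeasure_mem_ball η).mono fun t ht => ball_subset_ball (min_le_left _ _) ht
  have hgint := integrable_bumpMeasure η hgi
  have hφ : ∀ x, ∫ t, g (x - t) ∂bumpMeasure η ≠ 0 → x ∈ Ω ∧ δ / 2 ≤ distBd Ω x := fun x hx =>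
    mem_and_le_distBd_of_integral_bumpMeasure_ne_zero hopen hsupp hδ η (min_le_right _ _) hx
  have hsmooth := contDiff_integral_bumpMeasure η hgi
  obtain ⟨hcs, hts⟩ := hasCompactSupport_and_tsupport_subset hopen hbdd (by linarith) hφ
  refine ⟨fun x => ∫ t, g (x - t) ∂bumpMeasure η, hsmooth, hcs, hts, ?_⟩
  have hhm : Measurable fun x => g x - ∫ t, g (x - t) ∂bumpMeasure η :=
    hg.sub hsmooth.continuous.measurable
  have hhsupp : ∀ x, g x - ∫ t, g (x - t) ∂bumpMeasure η ≠ 0 → 2 * (δ / 4) ≤ distBd Ω x := by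
    intro x hx
    by_cases h0 : g x = 0
    · have := (hφ x fun h => hx (by rw [h0, h, sub_zero])).2
      linarith
    · have := (hsupp x h0).2
      linarith
  have hM : ∫⁻ x, ENNReal.ofReal (|g x - ∫ t, g (x - t) ∂bumpMeasure η| ^ p) ≤ n :=
    lintegral_abs_sub_average_le hp hg measurable_id hgint
      (hηr.mono fun t ht => (hball t ht).1.le)
  have hquot : ∀ z : Rd d × Rd d,
      nearQuotient (δ / 4) s p (fun x => g x - ∫ t, g (x - t) ∂bumpMeasure η) z =
        nearQuotient (δ / 4) s p g z -
          ∫ t, nearQuotient (δ / 4) s p g (z - (t, t)) ∂bumpMeasure η := by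
    intro z
    simp only [nearQuotient_sub_diag]
    rw [integral_const_mul, integral_sub (hgint _) (hgint _)]
    simp only [nearQuotient]
    ring
  have hN : ∫⁻ z, ENNReal.ofReal (|nearQuotient (δ / 4) s p
      (fun x => g x - ∫ t, g (x - t) ∂bumpMeasure η) z| ^ p) ≤ n := by
    simp only [hquot]
    refine lintegral_abs_sub_average_le (T := fun t : Rd d => (t, t)) hp hG (by fun_prop)
      (fun z => ?_) (hηr.mono fun t ht => (hball t ht).2.le)
    simp only [nearQuotient_sub_diag]
    exact ((hgint _).sub (hgint _)).const_mul _
  calc _ ≤ K * ((n : ℝ≥0∞) + n) := (hKle _ hhm hhsupp).trans (by gcongr)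
    _ = n * (2 * K) := by ring
    _ < ε := hnlt

end Mollification

section Characterisation

variable {d : ℕ} {Ω : Set (Rd d)} {s p α β : ℝ}

lemma energy_lt_top_of_sub (hp : 1 ≤ p) {f g : Rd d → ℝ} (hf : Measurable f) (hg : Measurable g)
    (hfE : energy Ω s p α β f < ⊤) (hfg : energy Ω s p α β (fun x => f x - g x) < ⊤) :
    energy Ω s p α β g < ⊤ := by
  have h := energy_add_le (Ω := Ω) (s := s) (α := α) (β := β) hp hf (hf.sub hg).neg
  have hfg' : energy Ω s p α β (-(f - g)) = energy Ω s p α β (fun x => f x - g x) :=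
    energy_neg (fun x => f x - g x)
  rw [hfg'] at h
  have heq : (fun x => f x + (-(f - g)) x) = g := by
    ext x
    simp
  rw [heq] at h
  exact h.trans_lt (ENNReal.mul_lt_top ENNReal.ofReal_lt_top (ENNReal.add_lt_top.2 ⟨hfE, hfg⟩))

lemma wNorm_lt_of_energy_le (hp : 1 ≤ p) {f : Rd d → ℝ} {ε : ℝ} (hε : 0 < ε)
    (hf : energy Ω s p α β f ≤ ENNReal.ofReal (ε / 4) ^ p) :
    wNorm Ω s p α β f < ENNReal.ofReal ε := by
  have hp0 : 0 < p := by linarith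
  have hroot : ∀ a ≤ energy Ω s p α β f, a ^ (1 / p) ≤ ENNReal.ofReal (ε / 4) := fun a ha => by
    have h := ENNReal.rpow_le_rpow (ha.trans hf) (by positivity : (0 : ℝ) ≤ 1 / p)
    rwa [← ENNReal.rpow_mul, mul_one_div_cancel hp0.ne', ENNReal.rpow_one] at h
  rw [wNorm, gagSemi, eLpNorm_eq_lintegral_abs_rpow hp]
  calc _ ≤ ENNReal.ofReal (ε / 4) + ENNReal.ofReal (ε / 4) :=
        add_le_add (hroot _ le_self_add) (hroot _ le_add_self)
    _ = ENNReal.ofReal (ε / 4 + ε / 4) :=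
        (ENNReal.ofReal_add (by positivity) (by positivity)).symm
    _ < ENNReal.ofReal ε := (ENNReal.ofReal_lt_ofReal_iff hε).2 (by linarith)

lemma memW0_of_lintegral_hardy_lt_top (hopen : IsOpen Ω) (hbdd : Bornology.IsBounded Ω)
    (hfr : (frontier Ω).Nontrivial) (hs0 : 0 < s) (hs1 : s < 1) (hp : 1 ≤ p)
    (hα0 : 0 ≤ α) (hα : α < lowerCodimA (frontier Ω))
    (hβ0 : 0 ≤ β) (hβ : β < lowerCodimA (frontier Ω)) {f : Rd d → ℝ} (hf : Measurable f)
    (hW : memW Ω s p α β f)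
    (hI : ∫⁻ x in Ω, ENNReal.ofReal (|f x| ^ p * distBd Ω x ^ (-(s * p + α + β))) < ⊤) :
    memW0 Ω s p α β f := by
  have hp0 : 0 < p := by linarith
  have hE := (memW_iff_energy_lt_top hp hf).1 hW
  refine ⟨hW, fun ε hε => ?_⟩
  have htarget : ENNReal.ofReal (ε / 4) ^ p ≠ 0 :=
    (ENNReal.rpow_pos (by simpa using hε) ENNReal.ofReal_ne_top).ne'
  obtain ⟨n, hn, hnlt⟩ := ENNReal.exists_nnreal_pos_mul_lt
    (ENNReal.mul_ne_top ENNReal.ofNat_ne_top ENNReal.ofReal_ne_top :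
      2 * ENNReal.ofReal (2 ^ p) ≠ ⊤) htarget
  have hn' : (0 : ℝ≥0∞) < n := by exact_mod_cast hn
  obtain ⟨g, hg, ⟨δ, hδ, hsupp⟩, hfg⟩ :=
    exists_compactly_supported_approx hopen hbdd hfr hs0 hs1 hp hβ0 hβ hf hE hI hn'
  have hgE : energy Ω s p α β g < ⊤ := energy_lt_top_of_sub hp hf hg hE (hfg.trans_le le_top)
  obtain ⟨φ, hφ, hφc, hφs, hgφ⟩ :=
    exists_smooth_approx hopen hbdd hfr hs0 hp hα0 hα hβ0 hβ hg hδ hsupp hgE hn'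
  have hφm : Measurable φ := hφ.continuous.measurable
  have hfφ : energy Ω s p α β (fun x => f x - φ x) ≤ ENNReal.ofReal (ε / 4) ^ p := by
    have h1 := energy_add_le (Ω := Ω) (s := s) (α := α) (β := β) hp (hf.sub hg) (hg.sub hφm)
    have heq : (fun x => (f - g) x + (g - φ) x) = fun x => f x - φ x := by
      ext x
      simp
    rw [heq] at h1
    refine h1.trans (le_trans ?_ hnlt.le)
    calc _ ≤ ENNReal.ofReal (2 ^ p) * ((n : ℝ≥0∞) + n) :=
          mul_le_mul_right (add_le_add hfg.le hgφ.le) _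
      _ = n * (2 * ENNReal.ofReal (2 ^ p)) := by ring
  refine ⟨φ, hφ, hφc, hφs, ?_, wNorm_lt_of_energy_le hp hε hfφ⟩
  exact (memW_iff_energy_lt_top hp hφm).2 (energy_lt_top_of_sub hp hf hφm hE
    (hfφ.trans_lt (ENNReal.rpow_lt_top_of_nonneg hp0.le ENNReal.ofReal_ne_top)))

end Characterisation

/-- for a bounded uniform domain with `0 ≤ α, β < codim_A(∂Ω)` and
`sp + α + β > upper codim_A(∂Ω)`, the space `W_0^{s,p;α,β}(Ω)` consists exactly of those
`f ∈ W^{s,p;α,β}(Ω)` with `∫_Ω |f|^p d_Ω^{-sp-α-β} < ∞`. -/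
theorem stmt6 {d : ℕ} (Ω : Set (Rd d)) (hne : Ω.Nonempty)
    (hopen : IsOpen Ω) (hconn : IsConnected Ω) (hbdd : Bornology.IsBounded Ω)
    (hunif : IsUniformDomain Ω) (s p α β : ℝ)
    (hs0 : 0 < s) (hs1 : s < 1) (hp : 1 ≤ p)
    (hα0 : 0 ≤ α) (hα : α < lowerCodimA (frontier Ω))
    (hβ0 : 0 ≤ β) (hβ : β < lowerCodimA (frontier Ω))
    (h : upperCodimA (frontier Ω) < s * p + α + β) :
    ∀ f : Rd d → ℝ, memW0 Ω s p α β f ↔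
      (memW Ω s p α β f ∧
        (∫⁻ x in Ω, ENNReal.ofReal (|f x| ^ p * distBd Ω x ^ (-(s * p + α + β)))) < ⊤) := by
  intro f
  have hfr := nontrivial_of_lt_lowerCodimA hα0 hα
  have key : ∀ g : Rd d → ℝ, Measurable g → (memW0 Ω s p α β g ↔ (memW Ω s p α β g ∧
      (∫⁻ x in Ω, ENNReal.ofReal (|g x| ^ p * distBd Ω x ^ (-(s * p + α + β)))) < ⊤)) :=
    fun g hg => ⟨fun hW => ⟨hW.1, lintegral_hardy_lt_top_of_memW0 hopen hunif hbdd hfr hs0 hp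
      hα0 hβ0 h hg hW⟩, fun hW => memW0_of_lintegral_hardy_lt_top hopen hbdd hfr hs0 hs1 hp
      hα0 hα hβ0 hβ hg hW.1 hW.2⟩
  by_cases hf : AEStronglyMeasurable f (volume.restrict Ω)
  · have hae := hf.ae_eq_mk
    have hI : (∫⁻ x in Ω, ENNReal.ofReal (|f x| ^ p * distBd Ω x ^ (-(s * p + α + β)))) =
        ∫⁻ x in Ω, ENNReal.ofReal (|hf.mk f x| ^ p * distBd Ω x ^ (-(s * p + α + β))) :=
      lintegral_congr_ae (hae.mono fun x hx => by
        dsimp only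
        rw [hx])
    rw [memW0_congr_ae hae, memW_congr_ae hae, hI]
    exact key _ hf.stronglyMeasurable_mk.measurable
  · exact ⟨fun hW => absurd hW.1.1.1 hf, fun hW => absurd hW.1.1.1 hf⟩
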